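/- Continuity of the phase transition conditionally on the equality of plus- and free-boundary two-point functions at criticality: if for all x, y ∈ ℤ³ one has inf_{L > max(‖x‖_∞, ‖y‖_∞)} ⟨cos(θ_x − θ_y)⟩_{L,+,β_c} = ⟨S_x·S_y⟩_{0,β_c}, then the magnetization vanishes at the critical point: m*(β_c) = 0. -/

import Mathlib

open MeasureTheory Real Filter

noncomputable section

abbrev Site : Type := Fin 3 → ℤ

/-- Nearest-neighbor adjacency on `ℤ³`. -/
def adj (k l : Site) : Prop := (∑ i, |k i - l i|) = 1

instance (k l : Site) : Decidable (adj k l) := by unfold adj; infer_instance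

/-- The interior `Λ_L° = ((-L,L) ∩ ℤ)³`. -/
def interF (L : ℕ) : Finset Site := Finset.Icc (fun _ => -(L : ℤ) + 1) (fun _ => (L : ℤ) - 1)

/-- The box `Λ_L = ([-L,L] ∩ ℤ)³`. -/
def lamF (L : ℕ) : Finset Site := Finset.Icc (fun _ => -(L : ℤ)) (fun _ => (L : ℤ))

/-- Configurations of angles on the interior of `Λ_L`. -/
abbrev Cfg (L : ℕ) : Type := ↥(interF L) → ℝ

/-- The cube `[0,2π]^{Λ_L°}`. -/
def cube (L : ℕ) : Set (Cfg L) := Set.univ.pi fun _ => Set.Icc 0 (2 * π)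

/-- Evaluation of a configuration at a site (`0` outside the interior). -/
def val (L : ℕ) (θ : Cfg L) (x : Site) : ℝ := if h : x ∈ interF L then θ ⟨x, h⟩ else 0

/-- Free-boundary energy `(β/6) Σ_{k,l ∈ Λ_L°, |k-l|=1} cos(θ_k - θ_l)`. -/
def energy0 (L : ℕ) (β : ℝ) (θ : Cfg L) : ℝ :=
  β / 6 * ∑ k : ↥(interF L), ∑ l : ↥(interF L),
    if adj k.1 l.1 then Real.cos (θ k - θ l) else 0

/-- `N_∂(k)`, the number of boundary neighbors of `k`. -/
def nBd (L : ℕ) (k : Site) : ℕ := ((lamF L \ interF L).filter fun l => adj k l).card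

/-- Plus-boundary energy. -/
def energyP (L : ℕ) (β : ℝ) (θ : Cfg L) : ℝ :=
  energy0 L β θ + β / 3 * ∑ k : ↥(interF L), (nBd L k.1 : ℝ) * Real.cos (θ k)

/-- Free-boundary expectation `⟨F⟩_{L,0,β}`. -/
def avg0 (L : ℕ) (β : ℝ) (F : Cfg L → ℝ) : ℝ :=
  (∫ θ in cube L, F θ * Real.exp (energy0 L β θ)) / ∫ θ in cube L, Real.exp (energy0 L β θ)

/-- Plus-boundary expectation `⟨F⟩_{L,+,β}`. -/
def avgP (L : ℕ) (β : ℝ) (F : Cfg L → ℝ) : ℝ :=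
  (∫ θ in cube L, F θ * Real.exp (energyP L β θ)) / ∫ θ in cube L, Real.exp (energyP L β θ)

/-- Free-boundary two-point function `⟨cos(θ_x - θ_y)⟩_{L,0,β}`. -/
def corr0 (L : ℕ) (β : ℝ) (x y : Site) : ℝ :=
  avg0 L β fun θ => Real.cos (val L θ x - val L θ y)

/-- Plus-boundary two-point function `⟨cos(θ_x - θ_y)⟩_{L,+,β}`. -/
def corrPlus (L : ℕ) (β : ℝ) (x y : Site) : ℝ :=
  avgP L β fun θ => Real.cos (val L θ x - val L θ y)

/-- Finite-volume plus-boundary magnetization at site `y`. -/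
def magAt (L : ℕ) (β : ℝ) (y : Site) : ℝ := avgP L β fun θ => Real.cos (val L θ y)

/-- The spontaneous magnetization `m*(β) = inf_{L ≥ 2} ⟨cos θ_0⟩_{L,+,β}`. -/
def mStar (β : ℝ) : ℝ := sInf {r : ℝ | ∃ L : ℕ, 2 ≤ L ∧ r = magAt L β 0}

/-- The critical inverse temperature `β_c`. -/
def critBeta : ℝ := sSup {β : ℝ | 0 < β ∧ mStar β = 0}

/-- Sup-norm on `ℤ³`. -/
def supNorm (x : Site) : ℤ := max |x 0| (max |x 1| |x 2|)

/-- Infinite-volume free-boundary two-point function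
`⟨S_x·S_y⟩_{0,β} = sup_{L > max(‖x‖∞,‖y‖∞)} ⟨cos(θ_x - θ_y)⟩_{L,0,β}`. -/
def S20 (β : ℝ) (x y : Site) : ℝ :=
  sSup {r : ℝ | ∃ L : ℕ, max (supNorm x) (supNorm y) < (L : ℤ) ∧ r = corr0 L β x y}

/-- The box `B_n = {z ∈ ℤ³ : max |z_i| ≤ n}`. -/
def Bn (n : ℕ) : Finset Site := Finset.Icc (fun _ => -(n : ℤ)) (fun _ => (n : ℤ))

/-- Fundamental domain `{-L,…,L-1}³` for the torus `T_L = (ℤ/2Lℤ)³`. -/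
def torF (L : ℕ) : Finset Site := Finset.Icc (fun _ => -(L : ℤ)) (fun _ => (L : ℤ) - 1)

/-- Distance on `ℤ/2Lℤ`. -/
def torDist (L : ℕ) (m : ℤ) : ℤ := min (m % (2 * (L : ℤ))) (2 * (L : ℤ) - m % (2 * (L : ℤ)))

/-- Graph adjacency on the torus `T_L`. -/
def adjT (L : ℕ) (k l : Site) : Prop := (∑ i, torDist L (k i - l i)) = 1

instance (L : ℕ) (k l : Site) : Decidable (adjT L k l) := by unfold adjT; infer_instance

abbrev TCfg (L : ℕ) : Type := ↥(torF L) → ℝ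

def cubeT (L : ℕ) : Set (TCfg L) := Set.univ.pi fun _ => Set.Icc 0 (2 * π)

def valT (L : ℕ) (θ : TCfg L) (x : Site) : ℝ := if h : x ∈ torF L then θ ⟨x, h⟩ else 0

/-- Periodic-boundary energy on the torus `T_L`. -/
def energyT (L : ℕ) (β : ℝ) (θ : TCfg L) : ℝ :=
  β / 6 * ∑ k : ↥(torF L), ∑ l : ↥(torF L),
    if adjT L k.1 l.1 then Real.cos (θ k - θ l) else 0

/-- Periodic-boundary expectation `⟨F⟩_{L,P,β}`. -/
def avgT (L : ℕ) (β : ℝ) (F : TCfg L → ℝ) : ℝ :=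
  (∫ θ in cubeT L, F θ * Real.exp (energyT L β θ)) / ∫ θ in cubeT L, Real.exp (energyT L β θ)

/-- Periodic two-point function `⟨cos(θ_x - θ_y)⟩_{L,P,β}`. -/
def corrT (L : ℕ) (β : ℝ) (x y : Site) : ℝ :=
  avgT L β fun θ => Real.cos (valT L θ x - valT L θ y)

/-- `Ĵ(k) = (cos k₁ + cos k₂ + cos k₃)/3`. -/
def Jhat (k : Fin 3 → ℝ) : ℝ := (Real.cos (k 0) + Real.cos (k 1) + Real.cos (k 2)) / 3

/-- The cube `[-π,π]³`. -/
def Qpi : Set (Fin 3 → ℝ) := Set.univ.pi fun _ => Set.Icc (-π) π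

/-- The lattice Green-type function `G(v)`. -/
def green (v : Site) : ℝ :=
  ((2 * π) ^ 3)⁻¹ * ∫ k in Qpi, Real.cos (∑ i, k i * (v i : ℝ)) / (1 - Jhat k)

/-- `G(x,y) := G(x-y)`. -/
def greenXY (x y : Site) : ℝ := green (x - y)

end

namespace XY

instance fact_two_pi_pos : Fact (0 < 2 * π) := ⟨Real.two_pi_pos⟩

section ExpKernel

variable {X I : Type*} [TopologicalSpace X] [CompactSpace X] [MeasurableSpace X] [BorelSpace X]
  {μ : Measure X} [IsFiniteMeasure μ]

theorem integrable_of_continuous {f : X → ℝ} (hf : Continuous f) : Integrable f μ :=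
  hf.integrable_of_hasCompactSupport (HasCompactSupport.of_compactSpace f)

variable [SecondCountableTopology X] [Fintype I]

/-- The integral of `F ⊗ G` against the partial exponential series of `∑ i, u i ⊗ v i`. -/
theorem integral_expSeries {F G : X → ℝ} {u v : I → X → ℝ} (hF : Continuous F) (hG : Continuous G)
    (hu : ∀ i, Continuous (u i)) (hv : ∀ i, Continuous (v i)) (n : ℕ) :
    ∫ z, F z.1 * G z.2 * ∑ k ∈ Finset.range n, (∑ i, u i z.1 * v i z.2) ^ k / (k.factorial : ℝ)
        ∂(μ.prod μ) =
      ∑ k ∈ Finset.range n, ∑ p : Fin k → I, (∫ x, F x * ∏ j, u (p j) x ∂μ) *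
        (∫ x, G x * ∏ j, v (p j) x ∂μ) / (k.factorial : ℝ) := by
  have h1 : ∀ z : X × X, F z.1 * G z.2 * ∑ k ∈ Finset.range n,
      (∑ i, u i z.1 * v i z.2) ^ k / (k.factorial : ℝ) =
      ∑ k ∈ Finset.range n, ∑ p : Fin k → I,
        ((F z.1 * ∏ j, u (p j) z.1) * (G z.2 * ∏ j, v (p j) z.2)) / (k.factorial : ℝ) := by
    intro z
    rw [Finset.mul_sum]
    refine Finset.sum_congr rfl fun k _ => ?_
    rw [Fintype.sum_pow, Finset.sum_div, Finset.mul_sum]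
    refine Finset.sum_congr rfl fun p _ => ?_
    rw [Finset.prod_mul_distrib]
    ring
  simp_rw [h1]
  rw [integral_finsetSum]
  · refine Finset.sum_congr rfl fun k _ => ?_
    rw [integral_finsetSum]
    · refine Finset.sum_congr rfl fun p _ => ?_
      rw [integral_div, integral_prod_mul (fun x => F x * ∏ j, u (p j) x)
        (fun x => G x * ∏ j, v (p j) x)]
    · intro p _
      exact integrable_of_continuous (by fun_prop)
  · intro k _
    exact integrable_of_continuous (by fun_prop)

theorem tendsto_integral_expSeries {F G : X → ℝ} {u v : I → X → ℝ} (hF : Continuous F)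
    (hG : Continuous G) (hu : ∀ i, Continuous (u i)) (hv : ∀ i, Continuous (v i)) :
    Tendsto (fun n => ∑ k ∈ Finset.range n, ∑ p : Fin k → I, (∫ x, F x * ∏ j, u (p j) x ∂μ) *
        (∫ x, G x * ∏ j, v (p j) x ∂μ) / (k.factorial : ℝ)) atTop
      (nhds (∫ z, F z.1 * G z.2 * Real.exp (∑ i, u i z.1 * v i z.2) ∂(μ.prod μ))) := by
  simp_rw [← integral_expSeries hF hG hu hv]
  refine tendsto_integral_of_dominated_convergence
    (fun z : X × X => |F z.1 * G z.2| * Real.exp |∑ i, u i z.1 * v i z.2|) ?_ ?_ ?_ ?_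
  · intro n
    exact Continuous.aestronglyMeasurable (by fun_prop)
  · exact integrable_of_continuous (by fun_prop)
  · refine fun n => Eventually.of_forall fun z => ?_
    rw [Real.norm_eq_abs, abs_mul]
    refine mul_le_mul_of_nonneg_left ?_ (abs_nonneg _)
    refine (Finset.abs_sum_le_sum_abs _ _).trans ?_
    simp_rw [abs_div, abs_pow, Nat.abs_cast]
    exact Real.sum_le_exp_of_nonneg (abs_nonneg _) n
  · refine Eventually.of_forall fun z => Tendsto.const_mul _ ?_
    rw [Real.exp_eq_exp_ℝ]
    exact (NormedSpace.expSeries_div_hasSum_exp (∑ i, u i z.1 * v i z.2)).tendsto_sum_nat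

theorem integral_exp_kernel_nonneg {F : X → ℝ} {u : I → X → ℝ} (hF : Continuous F)
    (hu : ∀ i, Continuous (u i)) :
    0 ≤ ∫ z, F z.1 * F z.2 * Real.exp (∑ i, u i z.1 * u i z.2) ∂(μ.prod μ) := by
  refine ge_of_tendsto' (tendsto_integral_expSeries hF hF hu hu) fun n => ?_
  exact Finset.sum_nonneg fun k _ => Finset.sum_nonneg fun p _ =>
    div_nonneg (mul_self_nonneg _) (Nat.cast_nonneg _)

theorem integral_exp_kernel_le {F G : X → ℝ} {u v : I → X → ℝ} (hF : Continuous F)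
    (hG : Continuous G) (hu : ∀ i, Continuous (u i)) (hv : ∀ i, Continuous (v i)) :
    2 * ∫ z, F z.1 * G z.2 * Real.exp (∑ i, u i z.1 * v i z.2) ∂(μ.prod μ) ≤
      (∫ z, F z.1 * F z.2 * Real.exp (∑ i, u i z.1 * u i z.2) ∂(μ.prod μ)) +
      ∫ z, G z.1 * G z.2 * Real.exp (∑ i, v i z.1 * v i z.2) ∂(μ.prod μ) := by
  refine le_of_tendsto_of_tendsto'
    ((tendsto_integral_expSeries hF hG hu hv).const_mul 2)
    ((tendsto_integral_expSeries hF hF hu hu).add (tendsto_integral_expSeries hG hG hv hv))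
    fun n => ?_
  rw [Finset.mul_sum, ← Finset.sum_add_distrib]
  refine Finset.sum_le_sum fun k _ => ?_
  rw [Finset.mul_sum, ← Finset.sum_add_distrib]
  refine Finset.sum_le_sum fun p _ => ?_
  rw [← add_div, mul_div_assoc']
  refine div_le_div_of_nonneg_right ?_ (Nat.cast_nonneg _)
  nlinarith [sq_nonneg ((∫ x, F x * ∏ j, u (p j) x ∂μ) - ∫ x, G x * ∏ j, v (p j) x ∂μ)]

/-- Gaussian-kernel form of `integral_exp_kernel_le`. -/
theorem integral_gaussian_kernel_le {F G : X → ℝ} {u v : I → X → ℝ} (hF : Continuous F)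
    (hG : Continuous G) (hu : ∀ i, Continuous (u i)) (hv : ∀ i, Continuous (v i)) :
    2 * ∫ z, F z.1 * G z.2 * Real.exp (-∑ i, (u i z.1 - v i z.2) ^ 2 / 2) ∂(μ.prod μ) ≤
      (∫ z, F z.1 * F z.2 * Real.exp (-∑ i, (u i z.1 - u i z.2) ^ 2 / 2) ∂(μ.prod μ)) +
      ∫ z, G z.1 * G z.2 * Real.exp (-∑ i, (v i z.1 - v i z.2) ^ 2 / 2) ∂(μ.prod μ) := by
  have key : ∀ (a b : X → ℝ) (s t : I → X → ℝ) (z : X × X),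
      a z.1 * b z.2 * Real.exp (-∑ i, (s i z.1 - t i z.2) ^ 2 / 2) =
      (a z.1 * Real.exp (-∑ i, (s i z.1) ^ 2 / 2)) * (b z.2 * Real.exp (-∑ i, (t i z.2) ^ 2 / 2)) *
        Real.exp (∑ i, s i z.1 * t i z.2) := by
    intro a b s t z
    have : -∑ i, (s i z.1 - t i z.2) ^ 2 / 2 = (-∑ i, (s i z.1) ^ 2 / 2) +
        (-∑ i, (t i z.2) ^ 2 / 2) + ∑ i, s i z.1 * t i z.2 := by
      rw [← Finset.sum_neg_distrib, ← Finset.sum_neg_distrib, ← Finset.sum_neg_distrib,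
        ← Finset.sum_add_distrib, ← Finset.sum_add_distrib]
      exact Finset.sum_congr rfl fun i _ => by ring
    rw [this, Real.exp_add, Real.exp_add]
    ring
  simp_rw [key]
  exact integral_exp_kernel_le (F := fun x => F x * Real.exp (-∑ i, (u i x) ^ 2 / 2))
    (G := fun x => G x * Real.exp (-∑ i, (v i x) ^ 2 / 2)) (by fun_prop) (by fun_prop) hu hv

end ExpKernel

section Angles

/-- The circle of angles. -/
abbrev Ang : Type := AddCircle (2 * π)

/-- Cosine of an angle. -/
noncomputable def acos (a : Ang) : ℝ := Real.Angle.cos a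

/-- Sine of an angle. -/
noncomputable def asin (a : Ang) : ℝ := Real.Angle.sin a

@[fun_prop] theorem continuous_acos : Continuous acos := Real.Angle.continuous_cos
@[fun_prop] theorem continuous_asin : Continuous asin := Real.Angle.continuous_sin

theorem acos_coe (x : ℝ) : acos (x : Ang) = Real.cos x := Real.Angle.cos_coe x
theorem acos_zero : acos 0 = 1 := Real.Angle.cos_zero
theorem acos_neg (a : Ang) : acos (-a) = acos a := Real.Angle.cos_neg a
theorem asin_neg (a : Ang) : asin (-a) = -asin a := Real.Angle.sin_neg a
theorem acos_add (a b : Ang) : acos (a + b) = acos a * acos b - asin a * asin b :=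
  Real.Angle.cos_add a b
theorem acos_sub (a b : Ang) : acos (a - b) = acos a * acos b + asin a * asin b := by
  rw [sub_eq_add_neg, acos_add, acos_neg, asin_neg]; ring
theorem acos_sq_add_asin_sq (a : Ang) : acos a ^ 2 + asin a ^ 2 = 1 :=
  Real.Angle.cos_sq_add_sin_sq a
theorem acos_add_pi (a : Ang) : acos (a + (π : ℝ)) = -acos a := Real.Angle.cos_add_pi a
theorem acos_add_pi_div_two (a : Ang) : acos (a + (π / 2 : ℝ)) = -asin a :=
  Real.Angle.cos_add_pi_div_two a
theorem acos_sub_comm (a b : Ang) : acos (a - b) = acos (b - a) := by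
  rw [← acos_neg, neg_sub]
theorem acos_le_one (a : Ang) : acos a ≤ 1 := by
  nlinarith [acos_sq_add_asin_sq a, sq_nonneg (asin a), sq_nonneg (acos a - 1)]

theorem exists_half (a : Ang) : ∃ b : Ang, b + b = a := by
  induction a using QuotientAddGroup.induction_on with
  | H x => exact ⟨((x / 2 : ℝ) : Ang), by rw [← AddCircle.coe_add, add_halves]⟩

end Angles

section Haar

variable {V W : Type*} [Fintype V] [Fintype W]

/-- Angle configurations on a vertex set. -/
abbrev Conf (V : Type*) : Type _ := V → Ang

instance borelSpace_conf : BorelSpace (Conf V) := Pi.borelSpace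

instance borelSpace_conf_prod : BorelSpace (Conf V × Conf W) := Prod.borelSpace

/-- The uniform probability measure on angle configurations. -/
noncomputable abbrev unif (V : Type*) [Fintype V] : Measure (Conf V) :=
  Measure.pi fun _ => AddCircle.haarAddCircle

instance isAddHaarMeasure_prod : ((unif V).prod (unif W)).IsAddHaarMeasure :=
  Measure.prod.instIsAddHaarMeasure _ _

theorem integral_comp_hom_prod (f : Conf V × Conf V →+ Conf W) (hf : Continuous f)
    (hs : Function.Surjective f) {Φ : Conf W → ℝ} (hΦ : Continuous Φ) :
    ∫ z, Φ (f z) ∂((unif V).prod (unif V)) = ∫ η, Φ η ∂(unif W) := by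
  have hm : MeasurePreserving f ((unif V).prod (unif V)) (unif W) :=
    AddMonoidHom.measurePreserving hf hs (by simp)
  rw [← hm.map_eq, integral_map hf.aemeasurable hΦ.aestronglyMeasurable]

/-- The change of variables `(α, β) ↦ (α - β, α + β)`. -/
theorem integral_comp_sub_add {Φ : Conf V × Conf V → ℝ} (hΦ : Continuous Φ) :
    ∫ z, Φ (z.1 - z.2, z.1 + z.2) ∂((unif V).prod (unif V)) =
      ∫ z, Φ z ∂((unif V).prod (unif V)) := by
  let f : Conf V × Conf V →+ Conf V × Conf V :=
    { toFun := fun z => (z.1 - z.2, z.1 + z.2)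
      map_zero' := by simp
      map_add' := fun a b => by
        ext <;> simp <;> abel }
  have hf : Continuous f := by
    change Continuous fun z : Conf V × Conf V => (z.1 - z.2, z.1 + z.2)
    fun_prop
  have hs : Function.Surjective f := by
    rintro ⟨a, b⟩
    choose h hh using fun v => exists_half (b v - a v)
    refine ⟨(a + h, h), ?_⟩
    change (a + h - h, a + h + h) = (a, b)
    ext v
    · simp
    · simp only [Pi.add_apply]
      rw [add_assoc, hh, add_sub_cancel]
  have hm : MeasurePreserving f ((unif V).prod (unif V)) ((unif V).prod (unif V)) :=
    AddMonoidHom.measurePreserving hf hs rfl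
  conv_rhs => rw [← hm.map_eq, integral_map hf.aemeasurable hΦ.aestronglyMeasurable]
  rfl

theorem integral_add_hom (f : Conf W →+ Conf V) (hf : Continuous f) {Φ : Conf V → ℝ}
    (hΦ : Continuous Φ) :
    ∫ θ, ∫ η, Φ (θ + f η) ∂(unif W) ∂(unif V) = ∫ θ, Φ θ ∂(unif V) := by
  rw [integral_integral_swap (integrable_of_continuous (by unfold Function.uncurry; fun_prop))]
  simp_rw [fun η => integral_add_right_eq_self (μ := unif V) Φ (f η)]
  simp

end Haar

section Ginibre

variable {V W I : Type*} [Fintype V] [Fintype W] [Fintype I]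

/-- Duplicated-variable inequality comparing phase-shifted couplings with larger unshifted ones. -/
theorem ginibre_shifted (ψ : I → Conf W →+ Ang) (hψ : ∀ i, Continuous (ψ i))
    (χ : Conf W →+ Ang) (hχ : Continuous χ) (a : I → Ang) (b : Ang) {J J' : I → ℝ}
    (hJ : ∀ i, 0 ≤ J i) (hJJ' : ∀ i, J i ≤ J' i) :
    (∫ η, acos (χ η + b) * Real.exp (∑ i, J i * acos (ψ i η + a i)) ∂(unif W)) *
        ∫ η, Real.exp (∑ i, J' i * acos (ψ i η)) ∂(unif W) ≤
      (∫ η, Real.exp (∑ i, J i * acos (ψ i η + a i)) ∂(unif W)) *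
        ∫ η, acos (χ η) * Real.exp (∑ i, J' i * acos (ψ i η)) ∂(unif W) := by
  choose a' ha' using fun i => exists_half (a i)
  obtain ⟨b', hb'⟩ := exists_half b
  rw [mul_comm, mul_comm (∫ η, Real.exp (∑ i, J i * acos (ψ i η + a i)) ∂(unif W)),
    ← integral_prod_mul, ← integral_prod_mul, ← sub_nonneg, ← integral_sub
    (integrable_of_continuous (by fun_prop)) (integrable_of_continuous (by fun_prop)),
    ← integral_comp_sub_add (by fun_prop)]
  have hpos := integral_exp_kernel_nonneg (μ := unif W) (I := I ⊕ I)
    (F := fun η => asin (χ η + b'))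
    (u := Sum.elim (fun i η => √(J' i + J i) * acos (ψ i η + a' i))
      (fun i η => √(J' i - J i) * asin (ψ i η + a' i))) (by fun_prop) (by
        rintro (i | i)
        · simp only [Sum.elim_inl]; fun_prop
        · simp only [Sum.elim_inr]; fun_prop)
  refine (mul_nonneg (zero_le_two (α := ℝ)) hpos).trans_eq ?_
  rw [← integral_const_mul]
  refine integral_congr_ae (Eventually.of_forall fun z => ?_)
  obtain ⟨α, β⟩ := z
  have h1 : ∀ (ρ : Conf W →+ Ang) (d' : Ang), acos (ρ (α - β)) =
      acos (ρ α + d') * acos (ρ β + d') + asin (ρ α + d') * asin (ρ β + d') := by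
    intro ρ d'
    rw [← acos_sub, map_sub, add_sub_add_right_eq_sub]
  have h2 : ∀ (ρ : Conf W →+ Ang) (d d' : Ang), d' + d' = d → acos (ρ (α + β) + d) =
      acos (ρ α + d') * acos (ρ β + d') - asin (ρ α + d') * asin (ρ β + d') := by
    intro ρ d d' hd
    rw [← acos_add, map_add, ← hd, add_add_add_comm]
  have hexp : (∑ i, J' i * acos (ψ i (α - β))) + ∑ i, J i * acos (ψ i (α + β) + a i) =
      ∑ i : I ⊕ I, Sum.elim (fun i η => √(J' i + J i) * acos (ψ i η + a' i))
        (fun i η => √(J' i - J i) * asin (ψ i η + a' i)) i α *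
        Sum.elim (fun i η => √(J' i + J i) * acos (ψ i η + a' i))
        (fun i η => √(J' i - J i) * asin (ψ i η + a' i)) i β := by
    rw [Fintype.sum_sum_type, ← Finset.sum_add_distrib, ← Finset.sum_add_distrib]
    refine Finset.sum_congr rfl fun i _ => ?_
    simp only [Sum.elim_inl, Sum.elim_inr]
    rw [h1 (ψ i) (a' i), h2 (ψ i) (a i) (a' i) (ha' i)]
    have e1 := Real.mul_self_sqrt (show 0 ≤ J' i + J i by linarith [hJ i, hJJ' i])
    have e2 := Real.mul_self_sqrt (show 0 ≤ J' i - J i by linarith [hJ i, hJJ' i])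
    linear_combination (-acos (ψ i α + a' i) * acos (ψ i β + a' i)) * e1 -
      (asin (ψ i α + a' i) * asin (ψ i β + a' i)) * e2
  simp only
  rw [← hexp, Real.exp_add, h1 χ b', h2 χ b b' hb']
  ring

/-- Ginibre comparison along a homomorphism `f : Conf W →+ Conf V`. -/
theorem ginibre_hom (f : Conf W →+ Conf V) (hf : Continuous f)
    (φ : I → Conf V →+ Ang) (hφ : ∀ i, Continuous (φ i))
    (ψ : I → Conf W →+ Ang) (hψ : ∀ i, Continuous (ψ i))
    (χ : Conf V →+ Ang) (hχ : Continuous χ) {J J' : I → ℝ}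
    (hJ : ∀ i, 0 ≤ J i) (hJJ' : ∀ i, J i ≤ J' i)
    (hφψ : ∀ i, J i ≠ 0 → ∀ η, φ i (f η) = ψ i η) :
    (∫ θ, acos (χ θ) * Real.exp (∑ i, J i * acos (φ i θ)) ∂(unif V)) *
        ∫ η, Real.exp (∑ i, J' i * acos (ψ i η)) ∂(unif W) ≤
      (∫ θ, Real.exp (∑ i, J i * acos (φ i θ)) ∂(unif V)) *
        ∫ η, acos (χ (f η)) * Real.exp (∑ i, J' i * acos (ψ i η)) ∂(unif W) := by
  rw [← integral_add_hom f hf (Φ := fun θ => acos (χ θ) * Real.exp (∑ i, J i * acos (φ i θ)))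
    (by fun_prop), ← integral_add_hom f hf (Φ := fun θ => Real.exp (∑ i, J i * acos (φ i θ)))
    (by fun_prop), ← integral_mul_const, ← integral_mul_const]
  have hc : Continuous (Function.uncurry fun (θ : Conf V) (η : Conf W) =>
      acos (χ (θ + f η)) * Real.exp (∑ i, J i * acos (φ i (θ + f η)))) := by
    unfold Function.uncurry; fun_prop
  have hc' : Continuous (Function.uncurry fun (θ : Conf V) (η : Conf W) =>
      Real.exp (∑ i, J i * acos (φ i (θ + f η)))) := by
    unfold Function.uncurry; fun_prop
  refine integral_mono ?_ ?_ fun θ => ?_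
  · refine (integrable_of_continuous ?_).mul_const _
    simpa using continuous_parametric_integral_of_continuous (μ := unif W) hc isCompact_univ
  · refine (integrable_of_continuous ?_).mul_const _
    simpa using continuous_parametric_integral_of_continuous (μ := unif W) hc' isCompact_univ
  · have hχf : Continuous (χ.comp f) := hχ.comp hf
    have := ginibre_shifted ψ hψ (χ.comp f) hχf (fun i => φ i θ) (χ θ) hJ hJJ'
    have he : ∀ η : Conf W, ∑ i, J i * acos (φ i (θ + f η)) =
        ∑ i, J i * acos (ψ i η + φ i θ) := by
      intro η
      refine Finset.sum_congr rfl fun i _ => ?_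
      by_cases h : J i = 0
      · simp [h]
      · rw [map_add, hφψ i h, add_comm]
    have he' : ∀ η : Conf W, χ (θ + f η) = χ.comp f η + χ θ := fun η => by
      rw [map_add, add_comm, AddMonoidHom.comp_apply]
    simp only [he, he']
    exact this

end Ginibre

section Gibbs

variable {V W I : Type*} [Fintype V] [Fintype W] [Fintype I]

/-- Gibbs expectation with energy `∑ i, J i * cos (φ i θ)`. -/
noncomputable def gibbs (J : I → ℝ) (φ : I → Conf V →+ Ang) (F : Conf V → ℝ) : ℝ :=
  (∫ θ, F θ * Real.exp (∑ i, J i * acos (φ i θ)) ∂(unif V)) /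
    ∫ θ, Real.exp (∑ i, J i * acos (φ i θ)) ∂(unif V)

theorem partition_pos (J : I → ℝ) {φ : I → Conf V →+ Ang} (hφ : ∀ i, Continuous (φ i)) :
    0 < ∫ θ, Real.exp (∑ i, J i * acos (φ i θ)) ∂(unif V) :=
  integral_exp_pos (integrable_of_continuous (by fun_prop))

theorem gibbs_le_gibbs (f : Conf W →+ Conf V) (hf : Continuous f)
    {φ : I → Conf V →+ Ang} (hφ : ∀ i, Continuous (φ i))
    {ψ : I → Conf W →+ Ang} (hψ : ∀ i, Continuous (ψ i))
    (χ : Conf V →+ Ang) (hχ : Continuous χ) {J J' : I → ℝ}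
    (hJ : ∀ i, 0 ≤ J i) (hJJ' : ∀ i, J i ≤ J' i)
    (hφψ : ∀ i, J i ≠ 0 → ∀ η, φ i (f η) = ψ i η) :
    gibbs J φ (fun θ => acos (χ θ)) ≤ gibbs J' ψ (fun η => acos (χ (f η))) := by
  rw [gibbs, gibbs, div_le_div_iff₀ (partition_pos J hφ) (partition_pos J' hψ), mul_comm
    (∫ η, acos (χ (f η)) * _ ∂(unif W))]
  exact ginibre_hom f hf φ hφ ψ hψ χ hχ hJ hJJ' hφψ

theorem gibbs_nonneg {φ : I → Conf V →+ Ang} (hφ : ∀ i, Continuous (φ i))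
    (χ : Conf V →+ Ang) (hχ : Continuous χ) {J : I → ℝ} (hJ : ∀ i, 0 ≤ J i) :
    0 ≤ gibbs J φ (fun θ => acos (χ θ)) := by
  have h := ginibre_shifted φ hφ χ hχ 0 ((π : ℝ) : Ang) hJ fun i => le_rfl
  simp only [acos_add_pi, Pi.zero_apply, add_zero, neg_mul, integral_neg] at h
  have hZ := partition_pos J hφ
  refine div_nonneg ?_ hZ.le
  nlinarith

/-- Integrals over the cube `[0, 2π]^V` of functions of the angles mod `2π`. -/
theorem integral_cube {Φ : Conf V → ℝ} (hΦ : Continuous Φ) :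
    ∫ θ in (Set.univ.pi fun _ : V => Set.Icc 0 (2 * π)), Φ (fun v => (θ v : Ang)) =
      (2 * π) ^ Fintype.card V * ∫ θ, Φ θ ∂(unif V) := by
  have h1 : MeasurePreserving (fun x : ℝ => (x : Ang)) (volume.restrict (Set.Icc 0 (2 * π)))
      (volume : Measure Ang) := by
    have := AddCircle.measurePreserving_mk (2 * π) 0
    rwa [zero_add, restrict_Ioc_eq_restrict_Icc] at this
  have h2 := measurePreserving_pi (ι := V) _ _ (fun _ => h1)
  have h3 : (Measure.pi fun _ : V => (volume : Measure Ang)) =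
      ENNReal.ofReal (2 * π) ^ Fintype.card V • unif V := by
    refine Measure.pi_eq fun s _ => ?_
    simp [AddCircle.volume_eq_smul_haarAddCircle, Measure.pi_pi, Finset.prod_mul_distrib]
  rw [volume_pi, Measure.restrict_pi_pi]
  rw [show (∫ θ, Φ θ ∂(unif V)) = ((2 * π) ^ Fintype.card V)⁻¹ *
    ∫ θ, Φ θ ∂(Measure.pi fun _ : V => (volume : Measure Ang)) from ?_]
  · rw [mul_inv_cancel_left₀ (by positivity), ← h2.map_eq,
      integral_map h2.measurable.aemeasurable hΦ.aestronglyMeasurable]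
  · rw [h3, integral_smul_measure]
    simp [Real.pi_pos.le]

end Gibbs

section Lattice

/-- The standard basis of `ℤ³`. -/
def stdVec (i : Fin 3) : Site := Pi.single i 1

theorem adj_indicator (k l : Site) : (if adj k l then (1 : ℝ) else 0) =
    ∑ i, ((if l = k + stdVec i then 1 else 0) + if k = l + stdVec i then 1 else 0) := by
  obtain ⟨d, rfl⟩ : ∃ d, l = k + d := ⟨l - k, by abel⟩
  have h1 : ∀ i, (k + d = k + stdVec i) ↔ d = stdVec i := fun i => add_right_inj k
  have h2 : ∀ i, (k = k + d + stdVec i) ↔ d = -stdVec i := fun i => by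
    rw [add_assoc, left_eq_add, eq_neg_iff_add_eq_zero]
  have h3 : adj k (k + d) ↔ |d 0| + |d 1| + |d 2| = 1 := by
    simp [adj, Fin.sum_univ_three]
  simp only [h1, h2, h3, Fin.sum_univ_three]
  simp only [funext_iff, Fin.forall_fin_succ, stdVec]
  simp
  generalize d 0 = a
  generalize d 1 = b
  generalize d 2 = c
  by_cases h : |a| + |b| + |c| = 1
  · have ha := abs_nonneg a
    have hb := abs_nonneg b
    have hc := abs_nonneg c
    have : (|a| = 1 ∧ |b| = 0 ∧ |c| = 0) ∨ (|a| = 0 ∧ |b| = 1 ∧ |c| = 0) ∨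
        (|a| = 0 ∧ |b| = 0 ∧ |c| = 1) := by omega
    simp only [abs_eq_zero, abs_eq (zero_le_one' ℤ)] at this
    rcases this with ⟨rfl | rfl, rfl, rfl⟩ | ⟨rfl, rfl | rfl, rfl⟩ | ⟨rfl, rfl, rfl | rfl⟩ <;> simp
  · rw [if_neg h]
    have hne : ∀ x y z : ℤ, |x| + |y| + |z| = 1 → ¬ (a = x ∧ b = y ∧ c = z) := by
      rintro x y z hxyz ⟨rfl, rfl, rfl⟩
      exact h hxyz
    rw [if_neg (hne _ _ _ (by simp)), if_neg (hne _ _ _ (by simp)), if_neg (hne _ _ _ (by simp)),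
      if_neg (hne _ _ _ (by simp)), if_neg (hne _ _ _ (by simp)), if_neg (hne _ _ _ (by simp))]
    simp

/-- A symmetric nearest-neighbor sum over ordered pairs is twice the sum over oriented edges. -/
theorem sum_adj (S : Finset Site) (g : Site → Site → ℝ) (hg : ∀ k l, g k l = g l k) :
    ∑ k ∈ S, ∑ l ∈ S, (if adj k l then g k l else 0) =
      2 * ∑ k ∈ S, ∑ i, if k + stdVec i ∈ S then g k (k + stdVec i) else 0 := by
  have h1 : ∀ k l, (if adj k l then g k l else 0) =
      (∑ i, if l = k + stdVec i then g k l else 0) +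
        ∑ i, if k = l + stdVec i then g k l else 0 := by
    intro k l
    have : (if adj k l then g k l else 0) = (if adj k l then 1 else 0) * g k l := by
      rw [ite_mul, one_mul, zero_mul]
    rw [this, adj_indicator, Finset.sum_mul, ← Finset.sum_add_distrib]
    refine Finset.sum_congr rfl fun i _ => ?_
    rw [add_mul]
    simp only [ite_mul, one_mul, zero_mul]
  have h2 : ∑ k ∈ S, ∑ l ∈ S, ∑ i, (if l = k + stdVec i then g k l else 0) =
      ∑ k ∈ S, ∑ i, if k + stdVec i ∈ S then g k (k + stdVec i) else 0 := by
    refine Finset.sum_congr rfl fun k _ => ?_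
    rw [Finset.sum_comm]
    exact Finset.sum_congr rfl fun i _ => Finset.sum_ite_eq' S (k + stdVec i) (g k)
  have h3 : ∑ k ∈ S, ∑ l ∈ S, ∑ i, (if k = l + stdVec i then g k l else 0) =
      ∑ k ∈ S, ∑ l ∈ S, ∑ i, (if l = k + stdVec i then g k l else 0) := by
    rw [Finset.sum_comm]
    simp_rw [hg]
  simp_rw [h1, Finset.sum_add_distrib]
  rw [h3, h2]
  ring

theorem mem_interF {L : ℕ} {k : Site} : k ∈ interF L ↔ ∀ i, |k i| < L := by
  simp only [interF, Finset.mem_Icc, Pi.le_def, ← forall_and]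
  refine forall_congr' fun i => ?_
  rw [abs_lt]
  omega

theorem mem_lamF {L : ℕ} {k : Site} : k ∈ lamF L ↔ ∀ i, |k i| ≤ L := by
  simp only [lamF, Finset.mem_Icc, Pi.le_def, ← forall_and, abs_le]

theorem interF_subset_lamF (L : ℕ) : interF L ⊆ lamF L := fun _ hk =>
  mem_lamF.2 fun i => (mem_interF.1 hk i).le

theorem mem_lamF_add {L : ℕ} {k : Site} (hk : k ∈ interF L) (i : Fin 3) :
    k + stdVec i ∈ lamF L := by
  refine mem_lamF.2 fun j => ?_
  have h := mem_interF.1 hk j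
  rw [abs_lt] at h
  by_cases hij : j = i
  · subst hij; simp [stdVec, abs_le]; omega
  · simp [stdVec, hij, abs_le]; omega

theorem mem_lamF_of_add {L : ℕ} {k : Site} {i : Fin 3} (hk : k + stdVec i ∈ interF L) :
    k ∈ lamF L := by
  refine mem_lamF.2 fun j => ?_
  have h := mem_interF.1 hk j
  rw [abs_lt] at h
  by_cases hij : j = i
  · subst hij; simp [stdVec] at h; rw [abs_le]; omega
  · simp [stdVec, hij] at h; rw [abs_le]; omega

end Lattice

section Representation

/-- Evaluation of an angle configuration at a site (`0` outside the interior). -/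
noncomputable def evalHom (L : ℕ) (x : Site) : Conf ↥(interF L) →+ Ang :=
  if h : x ∈ interF L then Pi.evalAddMonoidHom _ ⟨x, h⟩ else 0

theorem evalHom_of_mem {L : ℕ} {x : Site} (h : x ∈ interF L) (θ : Conf ↥(interF L)) :
    evalHom L x θ = θ ⟨x, h⟩ := by
  simp [evalHom, h]

theorem evalHom_of_notMem {L : ℕ} {x : Site} (h : x ∉ interF L) (θ : Conf ↥(interF L)) :
    evalHom L x θ = 0 := by
  simp [evalHom, h]

@[fun_prop] theorem continuous_evalHom (L : ℕ) (x : Site) : Continuous (evalHom L x) := by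
  by_cases h : x ∈ interF L
  · have : ⇑(evalHom L x) = fun θ => θ ⟨x, h⟩ := funext (evalHom_of_mem h)
    rw [this]; fun_prop
  · have : ⇑(evalHom L x) = fun _ => 0 := funext (evalHom_of_notMem h)
    rw [this]; fun_prop

theorem coe_val (L : ℕ) (θ : Cfg L) (x : Site) :
    ((val L θ x : ℝ) : Ang) = evalHom L x (fun v => (θ v : Ang)) := by
  by_cases h : x ∈ interF L
  · rw [evalHom_of_mem h, val, dif_pos h]
  · rw [evalHom_of_notMem h, val, dif_neg h, AddCircle.coe_zero]

theorem cos_val_sub (L : ℕ) (θ : Cfg L) (x y : Site) : Real.cos (val L θ x - val L θ y) =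
    acos (evalHom L x (fun v => (θ v : Ang)) - evalHom L y (fun v => (θ v : Ang))) := by
  rw [← coe_val, ← coe_val, ← AddCircle.coe_sub, acos_coe]

/-- The angle difference along the edge from `p.1` in direction `p.2`. -/
noncomputable def edgeHom (L : ℕ) (p : Site × Fin 3) : Conf ↥(interF L) →+ Ang :=
  evalHom L p.1 - evalHom L (p.1 + stdVec p.2)

theorem edgeHom_apply (L : ℕ) (p : Site × Fin 3) (θ : Conf ↥(interF L)) :
    edgeHom L p θ = evalHom L p.1 θ - evalHom L (p.1 + stdVec p.2) θ := rfl

@[fun_prop] theorem continuous_edgeHom (L : ℕ) (p : Site × Fin 3) : Continuous (edgeHom L p) :=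
  (continuous_evalHom L p.1).sub (continuous_evalHom L _)

theorem sum_eq_sum_rep {R : Type*} [Fintype R] {rep : R → Site} (hinj : Function.Injective rep)
    {S : Finset Site} (hS : ∀ k ∈ S, ∃ r, rep r = k) (F : Site → ℝ) :
    ∑ k ∈ S, F k = ∑ r, if rep r ∈ S then F (rep r) else 0 := by
  classical
  rw [← Finset.sum_filter]
  refine (Finset.sum_nbij rep (by simp) hinj.injOn ?_ (by simp)).symm
  intro k hk
  obtain ⟨r, rfl⟩ := hS k hk
  exact ⟨r, by simpa using hk, rfl⟩

/-- Coupling constants of the free-boundary model. -/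
noncomputable def freeJ (L : ℕ) (β : ℝ) (p : Site × Fin 3) : ℝ :=
  if p.1 ∈ interF L ∧ p.1 + stdVec p.2 ∈ interF L then β / 3 else 0

theorem energy0_eq {R : Type*} [Fintype R] {rep : R → Site} (hinj : Function.Injective rep)
    {L : ℕ} (hS : ∀ k ∈ interF L, ∃ r, rep r = k) (β : ℝ) (θ : Cfg L) :
    energy0 L β θ = ∑ p : R × Fin 3, freeJ L β (rep p.1, p.2) *
      acos (edgeHom L (rep p.1, p.2) (fun v => (θ v : Ang))) := by
  set A : Conf ↥(interF L) := fun v => (θ v : Ang) with hA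
  have h1 : (∑ k : ↥(interF L), ∑ l : ↥(interF L),
      if adj k.1 l.1 then Real.cos (θ k - θ l) else 0) =
      ∑ k ∈ interF L, ∑ l ∈ interF L,
        if adj k l then acos (evalHom L k A - evalHom L l A) else 0 := by
    rw [← Finset.sum_coe_sort (interF L)]
    refine Finset.sum_congr rfl fun k _ => ?_
    rw [← Finset.sum_coe_sort (interF L)]
    refine Finset.sum_congr rfl fun l _ => ?_
    rw [evalHom_of_mem k.2, evalHom_of_mem l.2, hA]
    simp only [← AddCircle.coe_sub, acos_coe]
  rw [energy0, h1, sum_adj _ _ (fun k l => acos_sub_comm _ _), sum_eq_sum_rep hinj hS,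
    Fintype.sum_prod_type, Finset.mul_sum, Finset.mul_sum]
  refine Finset.sum_congr rfl fun r _ => ?_
  split_ifs with hr
  · rw [Finset.mul_sum, Finset.mul_sum]
    refine Finset.sum_congr rfl fun i _ => ?_
    simp only [freeJ, hr, true_and, edgeHom_apply]
    split_ifs <;> ring
  · simp [freeJ, hr]

theorem energyP_eq {R : Type*} [Fintype R] {rep : R → Site} (hinj : Function.Injective rep)
    {L : ℕ} (hS : ∀ k ∈ lamF L, ∃ r, rep r = k) (β : ℝ) :
    ∃ C, ∀ θ : Cfg L, energyP L β θ = (∑ p : R × Fin 3, β / 3 *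
      acos (edgeHom L (rep p.1, p.2) (fun v => (θ v : Ang)))) + C := by
  classical
  set D : ℝ := ∑ k ∈ lamF L \ interF L, ∑ l ∈ lamF L \ interF L, if adj k l then (1 : ℝ) else 0
    with hD
  set D' : ℝ := ∑ p : R × Fin 3,
    if rep p.1 ∈ lamF L ∧ rep p.1 + stdVec p.2 ∈ lamF L then (0 : ℝ) else 1 with hD'
  refine ⟨-(β / 3 * D') - β / 6 * D, fun θ => ?_⟩
  set A : Conf ↥(interF L) := fun v => (θ v : Ang) with hA
  set g : Site → Site → ℝ := fun k l => acos (evalHom L k A - evalHom L l A) with hg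
  have hgs : ∀ k l, g k l = g l k := fun k l => acos_sub_comm _ _
  have hadj : ∀ k l, adj k l ↔ adj l k := fun k l => by
    simp only [adj, abs_sub_comm (k _) (l _)]
  have h0 : energy0 L β θ = β / 6 * ∑ k ∈ interF L, ∑ l ∈ interF L,
      if adj k l then g k l else 0 := by
    rw [energy0, ← Finset.sum_coe_sort (interF L)]
    congr 1
    refine Finset.sum_congr rfl fun k _ => ?_
    rw [← Finset.sum_coe_sort (interF L)]
    refine Finset.sum_congr rfl fun l _ => ?_
    simp only [hg, evalHom_of_mem k.2, evalHom_of_mem l.2, hA, ← AddCircle.coe_sub, acos_coe]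
  have hcross : ∑ k : ↥(interF L), (nBd L k.1 : ℝ) * Real.cos (θ k) =
      ∑ k ∈ interF L, ∑ l ∈ lamF L \ interF L, if adj k l then g k l else 0 := by
    rw [← Finset.sum_coe_sort (interF L)]
    refine Finset.sum_congr rfl fun k _ => ?_
    have : ∀ l ∈ lamF L \ interF L, (if adj k l then g k l else 0) =
        (if adj k l then 1 else 0) * Real.cos (θ k) := fun l hl => by
      simp only [hg, evalHom_of_mem k.2, evalHom_of_notMem (Finset.mem_sdiff.1 hl).2, hA,
        sub_zero, acos_coe, ite_mul, one_mul, zero_mul]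
    rw [Finset.sum_congr rfl this, ← Finset.sum_mul, nBd, Finset.card_filter]
    push_cast
    rfl
  have hbd : ∑ k ∈ lamF L \ interF L, ∑ l ∈ lamF L \ interF L,
      (if adj k l then g k l else 0) = D := by
    refine Finset.sum_congr rfl fun k hk => Finset.sum_congr rfl fun l hl => ?_
    simp only [hg, evalHom_of_notMem (Finset.mem_sdiff.1 hl).2,
      evalHom_of_notMem (Finset.mem_sdiff.1 hk).2, sub_zero, acos_zero]
  have hcross' : ∑ k ∈ lamF L \ interF L, ∑ l ∈ interF L, (if adj k l then g k l else 0) =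
      ∑ k ∈ interF L, ∑ l ∈ lamF L \ interF L, if adj k l then g k l else 0 := by
    rw [Finset.sum_comm]
    refine Finset.sum_congr rfl fun k _ => Finset.sum_congr rfl fun l _ => ?_
    simp only [hadj l k, hgs l k]
  have hsplit : ∑ k ∈ lamF L, ∑ l ∈ lamF L, (if adj k l then g k l else 0) =
      ∑ k ∈ interF L, ∑ l ∈ interF L, (if adj k l then g k l else 0) +
      2 * ∑ k : ↥(interF L), (nBd L k.1 : ℝ) * Real.cos (θ k) + D := by
    simp only [← Finset.sum_sdiff (interF_subset_lamF L), Finset.sum_add_distrib]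
    rw [hbd, hcross', hcross]
    ring
  have hP : energyP L β θ = β / 6 * ∑ k ∈ lamF L, ∑ l ∈ lamF L, (if adj k l then g k l else 0) -
      β / 6 * D := by
    rw [energyP, h0, hsplit]
    ring
  have hR : ∑ p : R × Fin 3, acos (edgeHom L (rep p.1, p.2) A) =
      (∑ k ∈ lamF L, ∑ i, if k + stdVec i ∈ lamF L then g k (k + stdVec i) else 0) + D' := by
    rw [sum_eq_sum_rep hinj hS, hD', Fintype.sum_prod_type, Fintype.sum_prod_type,
      ← Finset.sum_add_distrib]
    refine Finset.sum_congr rfl fun r _ => ?_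
    have h1 : ∀ k i, ¬ (k ∈ lamF L ∧ k + stdVec i ∈ lamF L) → acos (edgeHom L (k, i) A) = 1 := by
      intro k i hki
      rw [edgeHom_apply, evalHom_of_notMem, evalHom_of_notMem, sub_zero, acos_zero]
      · exact fun h => hki ⟨mem_lamF_of_add h, interF_subset_lamF L h⟩
      · exact fun h => hki ⟨interF_subset_lamF L h, mem_lamF_add h i⟩
    split_ifs with hr
    · rw [← Finset.sum_add_distrib]
      refine Finset.sum_congr rfl fun i _ => ?_
      by_cases hi : rep r + stdVec i ∈ lamF L
      · simp only [hr, hi, and_self, if_true, add_zero, hg, edgeHom_apply]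
      · simp only [hr, hi, and_false, if_false, zero_add]
        exact h1 _ _ fun h => hi h.2
    · simp only [hr, false_and, if_false, zero_add]
      exact Finset.sum_congr rfl fun i _ => h1 _ _ fun h => hr h.1
  rw [hP, sum_adj _ _ hgs, ← Finset.mul_sum, hR]
  ring

theorem corr0_eq_gibbs {R : Type*} [Fintype R] {rep : R → Site} (hinj : Function.Injective rep)
    {L : ℕ} (hS : ∀ k ∈ interF L, ∃ r, rep r = k) (β : ℝ) (x y : Site) :
    corr0 L β x y = gibbs (fun p : R × Fin 3 => freeJ L β (rep p.1, p.2))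
      (fun p => edgeHom L (rep p.1, p.2)) (fun θ => acos ((evalHom L x - evalHom L y) θ)) := by
  simp only [corr0, avg0, gibbs, cos_val_sub, energy0_eq hinj hS, cube]
  rw [integral_cube (Φ := fun θ => acos (evalHom L x θ - evalHom L y θ) *
      Real.exp (∑ p : R × Fin 3, freeJ L β (rep p.1, p.2) *
      acos (edgeHom L (rep p.1, p.2) θ))) (by fun_prop),
    integral_cube (Φ := fun θ => Real.exp (∑ p : R × Fin 3, freeJ L β (rep p.1, p.2) *
      acos (edgeHom L (rep p.1, p.2) θ))) (by fun_prop), mul_div_mul_left _ _ (by positivity)]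
  rfl

theorem avgP_eq_gibbs {R : Type*} [Fintype R] {rep : R → Site} (hinj : Function.Injective rep)
    {L : ℕ} (hS : ∀ k ∈ lamF L, ∃ r, rep r = k) (β : ℝ) {F : Conf ↥(interF L) → ℝ}
    (hF : Continuous F) :
    avgP L β (fun θ => F fun v => (θ v : Ang)) = gibbs (fun _ : R × Fin 3 => β / 3)
      (fun p => edgeHom L (rep p.1, p.2)) F := by
  obtain ⟨C, hC⟩ := energyP_eq hinj hS β
  simp only [avgP, gibbs, hC, Real.exp_add, cube, ← mul_assoc, integral_mul_const]
  rw [mul_div_mul_right _ _ (Real.exp_pos C).ne',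
    integral_cube (Φ := fun θ => F θ *
      Real.exp (∑ p : R × Fin 3, β / 3 * acos (edgeHom L (rep p.1, p.2) θ))) (by fun_prop),
    integral_cube (Φ := fun θ =>
      Real.exp (∑ p : R × Fin 3, β / 3 * acos (edgeHom L (rep p.1, p.2) θ))) (by fun_prop),
    mul_div_mul_left _ _ (by positivity)]

theorem corrPlus_eq_gibbs {R : Type*} [Fintype R] {rep : R → Site} (hinj : Function.Injective rep)
    {L : ℕ} (hS : ∀ k ∈ lamF L, ∃ r, rep r = k) (β : ℝ) (x y : Site) :
    corrPlus L β x y = gibbs (fun _ : R × Fin 3 => β / 3)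
      (fun p => edgeHom L (rep p.1, p.2)) (fun θ => acos ((evalHom L x - evalHom L y) θ)) := by
  rw [← avgP_eq_gibbs hinj hS β (F := fun θ => acos ((evalHom L x - evalHom L y) θ))
    (by simp only [AddMonoidHom.sub_apply]; fun_prop), corrPlus]
  simp only [cos_val_sub]
  rfl

theorem magAt_eq_corrPlus {L : ℕ} (β : ℝ) (y : Site) {q : Site} (hq : q ∉ interF L) :
    magAt L β y = corrPlus L β y q := by
  have : ∀ θ, val L θ q = 0 := fun θ => by rw [val, dif_neg hq]
  simp only [magAt, corrPlus, this, sub_zero]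

end Representation

section Comparison

theorem corrPlus_mono {L' L : ℕ} {β : ℝ} (hβ : 0 ≤ β) (x p q : Site)
    (hL : ∀ k, k + x ∈ interF L → k ∈ interF L') :
    corrPlus L' β p q ≤ corrPlus L β (p + x) (q + x) := by
  classical
  let W : Finset Site := lamF L' ∪ (lamF L).image fun k => k - x
  have hW' : ∀ k ∈ lamF L', ∃ r : ↥W, (r : Site) = k := fun k hk =>
    ⟨⟨k, Finset.mem_union_left _ hk⟩, rfl⟩
  have hW : ∀ k ∈ lamF L, ∃ r : ↥W, (r : Site) + x = k := fun k hk =>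
    ⟨⟨k - x, Finset.mem_union_right _ (Finset.mem_image_of_mem _ hk)⟩, sub_add_cancel k x⟩
  rw [corrPlus_eq_gibbs Subtype.val_injective hW',
    corrPlus_eq_gibbs (rep := fun r : ↥W => (r : Site) + x)
      (fun a b hab => Subtype.ext (add_right_cancel hab)) hW]
  let f : Conf ↥(interF L) →+ Conf ↥(interF L') :=
    AddMonoidHom.pi fun k => evalHom L (k.1 + x)
  have hf : Continuous f := continuous_pi fun k => continuous_evalHom L _
  have hev : ∀ z η, evalHom L' z (f η) = evalHom L (z + x) η := by
    intro z η
    by_cases hz : z ∈ interF L'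
    · rw [evalHom_of_mem hz]; rfl
    · rw [evalHom_of_notMem hz, evalHom_of_notMem fun h => hz (hL z h)]
  have := gibbs_le_gibbs f hf (φ := fun r : ↥W × Fin 3 => edgeHom L' (r.1.1, r.2))
    (fun _ => continuous_edgeHom _ _)
    (ψ := fun r : ↥W × Fin 3 => edgeHom L (r.1.1 + x, r.2)) (fun _ => continuous_edgeHom _ _)
    (evalHom L' p - evalHom L' q) ((continuous_evalHom L' p).sub (continuous_evalHom L' q))
    (J := fun _ => β / 3) (J' := fun _ => β / 3) (fun _ => by positivity) (fun _ => le_rfl)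
    (fun r _ η => by
      rw [edgeHom_apply, edgeHom_apply, hev, hev]
      simp only [add_right_comm])
  simpa only [AddMonoidHom.sub_apply, hev] using this

/-- Evaluation at a vertex. -/
noncomputable def evalAt {V : Type*} (x : V) : Conf V →+ Ang := Pi.evalAddMonoidHom (fun _ => Ang) x

theorem evalAt_apply {V : Type*} (x : V) (θ : Conf V) : evalAt x θ = θ x := rfl

@[fun_prop] theorem continuous_evalAt {V : Type*} (x : V) : Continuous (evalAt x) :=
  continuous_apply x

/-- The discrete torus of side `n`. -/
abbrev Tor (n : ℕ) : Type := Fin 3 → ZMod n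

/-- The angle difference along the torus edge from `p.1` in direction `p.2`. -/
noncomputable def torEdge (n : ℕ) (p : Tor n × Fin 3) : Conf (Tor n) →+ Ang :=
  evalAt p.1 - evalAt (p.1 + Pi.single p.2 1)

theorem torEdge_apply (n : ℕ) (p : Tor n × Fin 3) (θ : Conf (Tor n)) :
    torEdge n p θ = θ p.1 - θ (p.1 + Pi.single p.2 1) := rfl

@[fun_prop] theorem continuous_torEdge (n : ℕ) (p : Tor n × Fin 3) : Continuous (torEdge n p) :=
  (continuous_evalAt p.1).sub (continuous_evalAt _)

/-- Two-point function of the torus model. -/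
noncomputable def torCorr (n : ℕ) [NeZero n] (β : ℝ) (x y : Tor n) : ℝ :=
  gibbs (fun _ => β / 3) (torEdge n) fun θ => acos (θ x - θ y)

/-- Reduction of a site modulo `n`. -/
def red (n : ℕ) (k : Site) : Tor n := fun i => (k i : ZMod n)

/-- The representative of smallest absolute value. -/
def rep {n : ℕ} (z : Tor n) : Site := fun i => (z i).valMinAbs

theorem red_rep {n : ℕ} (z : Tor n) : red n (rep z) = z :=
  funext fun i => ZMod.coe_valMinAbs (z i)

theorem rep_injective {n : ℕ} : Function.Injective (rep (n := n)) :=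
  Function.LeftInverse.injective red_rep

theorem red_add (n : ℕ) (k l : Site) : red n (k + l) = red n k + red n l :=
  funext fun i => by simp [red]

theorem red_stdVec (n : ℕ) (i : Fin 3) : red n (stdVec i) = Pi.single i 1 :=
  funext fun j => by
    by_cases h : j = i
    · subst h; simp [red, stdVec]
    · simp [red, stdVec, h]

theorem rep_red {n : ℕ} [NeZero n] {k : Site} (hk : ∀ i, 2 * |k i| < n) : rep (red n k) = k :=
  funext fun i => by
    have h := hk i
    have h1 := neg_abs_le (k i)
    have h2 := le_abs_self (k i)
    exact (ZMod.valMinAbs_spec _ _).2 ⟨rfl, by constructor <;> omega⟩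

theorem corr0_le_torCorr {L n : ℕ} [NeZero n] (hn : 2 * L ≤ n) {β : ℝ} (hβ : 0 ≤ β)
    {p q : Site} (hp : p ∈ interF L) (hq : q ∈ interF L) :
    corr0 L β p q ≤ torCorr n β (red n p) (red n q) := by
  have hS : ∀ k ∈ interF L, ∃ r : Tor n, rep r = k := fun k hk =>
    ⟨red n k, rep_red fun i => by have := mem_interF.1 hk i; omega⟩
  rw [corr0_eq_gibbs rep_injective hS]
  let f : Conf (Tor n) →+ Conf ↥(interF L) :=
    AddMonoidHom.pi fun k => evalAt (red n k.1)
  have hf : Continuous f := continuous_pi fun k => continuous_apply _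
  have hev : ∀ z ∈ interF L, ∀ η, evalHom L z (f η) = η (red n z) := fun z hz η => by
    rw [evalHom_of_mem hz]; rfl
  have := gibbs_le_gibbs f hf (φ := fun r : Tor n × Fin 3 => edgeHom L (rep r.1, r.2))
    (fun _ => continuous_edgeHom _ _) (ψ := torEdge n) (fun _ => continuous_torEdge _ _)
    (evalHom L p - evalHom L q) ((continuous_evalHom L p).sub (continuous_evalHom L q))
    (J := fun r => freeJ L β (rep r.1, r.2)) (J' := fun _ => β / 3)
    (fun r => by unfold freeJ; split_ifs <;> positivity)
    (fun r => by unfold freeJ; split_ifs <;> [exact le_rfl; positivity])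
    (fun r hr η => by
      have h : rep r.1 ∈ interF L ∧ rep r.1 + stdVec r.2 ∈ interF L := by
        by_contra h
        exact hr (if_neg h)
      rw [edgeHom_apply, torEdge_apply, hev _ h.1, hev _ h.2, red_add, red_rep, red_stdVec])
  simpa only [AddMonoidHom.sub_apply, hev p hp, hev q hq, torCorr] using this

theorem torCorr_le_magAt {L n : ℕ} [NeZero n] (hn : 2 * L < n) {β : ℝ} (hβ : 0 ≤ β)
    {x y : Tor n} (hxy : rep (y - x) ∉ interF L) : torCorr n β x y ≤ magAt L β 0 := by
  have hrep : ∀ k ∈ lamF L, rep (red n k) = k := fun k hk =>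
    rep_red fun i => by have := mem_lamF.1 hk i; omega
  have hS : ∀ k ∈ lamF L, ∃ r : Tor n, rep (r - x) = k := fun k hk =>
    ⟨red n k + x, by rw [add_sub_cancel_right, hrep k hk]⟩
  rw [magAt_eq_corrPlus β 0 hxy, corrPlus_eq_gibbs (rep := fun r : Tor n => rep (r - x))
    (fun a b hab => sub_left_injective (rep_injective hab)) hS]
  have hstep : ∀ (w : Tor n) i η,
      evalHom L (rep (w + Pi.single i 1)) η = evalHom L (rep w + stdVec i) η := by
    intro w i η
    by_cases h1 : rep w + stdVec i ∈ interF L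
    · rw [← hrep _ (interF_subset_lamF L h1), red_add, red_rep, red_stdVec]
    by_cases h2 : rep (w + Pi.single i 1) ∈ interF L
    · have h3 : rep (w + Pi.single i 1) - stdVec i ∈ lamF L :=
        mem_lamF_of_add (i := i) (by rwa [sub_add_cancel])
      have h4 : red n (rep (w + Pi.single i 1) - stdVec i) = w := by
        have := red_add n (rep (w + Pi.single i 1) - stdVec i) (stdVec i)
        rw [sub_add_cancel, red_rep, red_stdVec] at this
        exact (add_right_cancel this).symm
      have h5 := hrep _ h3
      rw [h4] at h5
      rw [h5, sub_add_cancel]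
    · rw [evalHom_of_notMem h1, evalHom_of_notMem h2]
  let f : Conf ↥(interF L) →+ Conf (Tor n) :=
    AddMonoidHom.pi fun z => evalHom L (rep (z - x))
  have hf : Continuous f := continuous_pi fun k => continuous_evalHom L _
  have hfz : ∀ η z, f η z = evalHom L (rep (z - x)) η := fun _ _ => rfl
  have := gibbs_le_gibbs f hf (φ := torEdge n) (fun _ => continuous_torEdge _ _)
    (ψ := fun r : Tor n × Fin 3 => edgeHom L (rep (r.1 - x), r.2))
    (fun _ => continuous_edgeHom _ _)
    (evalAt x - evalAt y)
    ((continuous_evalAt x).sub (continuous_evalAt y))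
    (J := fun _ => β / 3) (J' := fun _ => β / 3) (fun _ => by positivity) (fun _ => le_rfl)
    (fun r _ η => by
      rw [edgeHom_apply, torEdge_apply, hfz, hfz, ← hstep, add_sub_right_comm])
  have h0 : rep (0 : Tor n) = 0 := funext fun i => by simp [rep]
  simpa only [AddMonoidHom.sub_apply, evalAt_apply, hfz, sub_self, h0, torCorr] using this

end Comparison

section Magnetization

theorem corrPlus_nonneg (L : ℕ) {β : ℝ} (hβ : 0 ≤ β) (x y : Site) : 0 ≤ corrPlus L β x y := by
  rw [corrPlus_eq_gibbs (R := ↥(lamF L)) Subtype.val_injective fun k hk => ⟨⟨k, hk⟩, rfl⟩]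
  exact gibbs_nonneg (fun _ => continuous_edgeHom _ _) _
    ((continuous_evalHom L x).sub (continuous_evalHom L y)) fun _ => by positivity

theorem exists_notMem_interF (L : ℕ) : ∃ q, q ∉ interF L :=
  ⟨fun _ => L, fun h => by simpa using mem_interF.1 h 0⟩

theorem magAt_nonneg (L : ℕ) {β : ℝ} (hβ : 0 ≤ β) (x : Site) : 0 ≤ magAt L β x := by
  obtain ⟨q, hq⟩ := exists_notMem_interF L
  rw [magAt_eq_corrPlus β x hq]
  exact corrPlus_nonneg L hβ x q

theorem mStar_nonneg {β : ℝ} (hβ : 0 ≤ β) : 0 ≤ mStar β :=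
  Real.sInf_nonneg fun _ ⟨L, _, hr⟩ => hr ▸ magAt_nonneg L hβ 0

theorem mStar_le_magAt_zero {L : ℕ} (hL : 2 ≤ L) {β : ℝ} (hβ : 0 ≤ β) :
    mStar β ≤ magAt L β 0 :=
  csInf_le ⟨0, fun _ ⟨L, _, hr⟩ => hr ▸ magAt_nonneg L hβ 0⟩ ⟨L, hL, rfl⟩

theorem mStar_le_magAt (L : ℕ) {β : ℝ} (hβ : 0 ≤ β) (y : Site) : mStar β ≤ magAt L β y := by
  let L' : ℕ := L + 2 + ∑ i, (y i).natAbs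
  have hk : ∀ k, k + y ∈ interF L → k ∈ interF L' := fun k hk => mem_interF.2 fun i => by
    have h1 := mem_interF.1 hk i
    have h2 : (y i).natAbs ≤ ∑ i, (y i).natAbs :=
      Finset.single_le_sum (f := fun i => (y i).natAbs) (fun _ _ => Nat.zero_le _)
        (Finset.mem_univ i)
    rw [Pi.add_apply] at h1
    rw [abs_lt] at h1 ⊢
    have h3 : ((L' : ℕ) : ℤ) = L + 2 + ((∑ i, (y i).natAbs : ℕ) : ℤ) := by
      simp only [L']
      push_cast
      rfl
    rw [h3]
    generalize ∑ i, (y i).natAbs = S at h2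
    omega
  obtain ⟨q, hq⟩ := exists_notMem_interF L'
  have hq' : q + y ∉ interF L := fun h => hq (hk q h)
  have := corrPlus_mono hβ y 0 q hk
  rw [← magAt_eq_corrPlus β 0 hq, ← magAt_eq_corrPlus β _ hq', zero_add] at this
  exact (mStar_le_magAt_zero (by simp [L']; omega) hβ).trans this

theorem corrPlus_antitone {L' L : ℕ} (h : L ≤ L') {β : ℝ} (hβ : 0 ≤ β) (p q : Site) :
    corrPlus L' β p q ≤ corrPlus L β p q := by
  simpa using corrPlus_mono hβ 0 p q (L := L) (L' := L') fun k hk => mem_interF.2 fun i => by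
    have := mem_interF.1 hk i
    simp at this
    omega

end Magnetization

section ReflectionPositivity

/-- A reflection of a finite graph with oriented edges, exchanging the half `P` and its complement,
such that every edge between the two halves joins a vertex to its mirror image. -/
structure EdgeReflection {V E : Type*} (src tgt : E → V) where
  /-- the reflection of vertices -/
  r : V → V
  /-- the reflection of edges -/
  rE : E → E
  /-- `1` if the reflection of an edge keeps the orientation, `-1` otherwise -/
  sgn : E → ℝ
  /-- one of the halves -/
  P : V → Prop
  r_r : ∀ x, r (r x) = x
  rE_rE : ∀ e, rE (rE e) = e
  P_r : ∀ x, P (r x) ↔ ¬ P x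
  compat : ∀ e, (sgn e = 1 ∧ src (rE e) = r (src e) ∧ tgt (rE e) = r (tgt e)) ∨
    (sgn e = -1 ∧ src (rE e) = r (tgt e) ∧ tgt (rE e) = r (src e))
  cross : ∀ e, ¬ (P (src e) ↔ P (tgt e)) → r (src e) = tgt e

variable {V E : Type*} {src tgt : E → V}

variable (src tgt) in
/-- Energy of the edge `e` with shift `φ`. -/
noncomputable def edgeEnergy (b : ℝ) (φ : E → ℝ) (θ : Conf V) (e : E) : ℝ :=
  b / 2 * ((acos (θ (src e)) - acos (θ (tgt e)) + φ e) ^ 2 +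
    (asin (θ (src e)) - asin (θ (tgt e))) ^ 2)

variable (src tgt) in
/-- The partition function with shifts `φ`. -/
noncomputable def shiftedPartition [Fintype V] [Fintype E] (b : ℝ) (φ : E → ℝ) : ℝ :=
  ∫ θ, Real.exp (-∑ e, edgeEnergy src tgt b φ θ e) ∂(unif V)

@[fun_prop] theorem continuous_edgeEnergy (b : ℝ) (φ : E → ℝ) (e : E) :
    Continuous fun θ => edgeEnergy src tgt b φ θ e := by
  unfold edgeEnergy; fun_prop

namespace EdgeReflection

open Classical in
/-- Glue two configurations along a reflection. -/
noncomputable def glue (R : EdgeReflection src tgt) : Conf V × Conf V →+ Conf V where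
  toFun z x := if R.P x then z.1 x else z.2 (R.r x)
  map_zero' := by ext x; simp
  map_add' a b := by ext x; by_cases h : R.P x <;> simp [h]

theorem glue_of_mem (R : EdgeReflection src tgt) {x : V} (h : R.P x) (z : Conf V × Conf V) :
    R.glue z x = z.1 x := if_pos h

theorem glue_of_notMem (R : EdgeReflection src tgt) {x : V} (h : ¬ R.P x) (z : Conf V × Conf V) :
    R.glue z x = z.2 (R.r x) := if_neg h

theorem continuous_glue (R : EdgeReflection src tgt) : Continuous R.glue := by
  refine continuous_pi fun x => ?_
  by_cases h : R.P x
  · simp only [R.glue_of_mem h]; fun_prop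
  · simp only [R.glue_of_notMem h]; fun_prop

theorem glue_surjective (R : EdgeReflection src tgt) : Function.Surjective R.glue := by
  refine fun θ => ⟨(θ, fun x => θ (R.r x)), funext fun x => ?_⟩
  by_cases h : R.P x
  · rw [R.glue_of_mem h]
  · rw [R.glue_of_notMem h]
    exact congrArg θ (R.r_r x)

theorem sgn_mul_self (R : EdgeReflection src tgt) (e : E) : R.sgn e * R.sgn e = 1 := by
  rcases R.compat e with h | h <;> rw [h.1] <;> norm_num

/-- Reflected shifts. -/
def reflect (R : EdgeReflection src tgt) (φ : E → ℝ) (e : E) : ℝ :=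
  R.sgn (R.rE e) * φ (R.rE e)

theorem edgeEnergy_reflect (R : EdgeReflection src tgt) (b : ℝ) (φ : E → ℝ) (θ : Conf V) (e : E) :
    edgeEnergy src tgt b (R.reflect φ) θ (R.rE e) =
      edgeEnergy src tgt b φ (fun x => θ (R.r x)) e := by
  simp only [edgeEnergy, reflect, R.rE_rE]
  rcases R.compat e with ⟨h1, h2, h3⟩ | ⟨h1, h2, h3⟩ <;> rw [h1, h2, h3] <;> ring

open Classical in
/-- Energy of the edges inside `P`. -/
noncomputable def leftEnergy [Fintype E] (R : EdgeReflection src tgt) (b : ℝ) (φ : E → ℝ)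
    (θ : Conf V) : ℝ :=
  ∑ e, if R.P (src e) ∧ R.P (tgt e) then edgeEnergy src tgt b φ θ e else 0

theorem continuous_leftEnergy [Fintype E] (R : EdgeReflection src tgt) (b : ℝ) (φ : E → ℝ) :
    Continuous (R.leftEnergy b φ) := by
  unfold leftEnergy
  refine continuous_finsetSum _ fun e _ => ?_
  split_ifs <;> fun_prop

open Classical in
/-- The quantities coupled across the reflection. -/
noncomputable def crossTerm (R : EdgeReflection src tgt) (b : ℝ) (φ : E → ℝ) (i : E × Bool)
    (θ : Conf V) : ℝ :=
  if R.P (src i.1) ∧ ¬ R.P (tgt i.1) then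
    bif i.2 then √b * (acos (θ (src i.1)) + φ i.1) else √b * asin (θ (src i.1))
  else if R.P (tgt i.1) ∧ ¬ R.P (src i.1) then
    bif i.2 then √b * (acos (θ (tgt i.1)) - φ i.1) else √b * asin (θ (tgt i.1))
  else 0

theorem continuous_crossTerm (R : EdgeReflection src tgt) (b : ℝ) (φ : E → ℝ) (i : E × Bool) :
    Continuous (R.crossTerm b φ i) := by
  unfold crossTerm
  obtain ⟨e, _ | _⟩ := i <;> split_ifs <;>
    first | fun_prop | (dsimp only [cond_true, cond_false]; fun_prop)

theorem rE_mem_right (R : EdgeReflection src tgt) (e : E) :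
    (¬ R.P (src (R.rE e)) ∧ ¬ R.P (tgt (R.rE e))) ↔ R.P (src e) ∧ R.P (tgt e) := by
  rcases R.compat e with ⟨-, h2, h3⟩ | ⟨-, h2, h3⟩ <;> rw [h2, h3, R.P_r, R.P_r] <;> tauto

theorem sum_rE [Fintype E] {M : Type*} [AddCommMonoid M] (R : EdgeReflection src tgt)
    (f : E → M) : ∑ e, f (R.rE e) = ∑ e, f e :=
  Equiv.sum_comp (Function.Involutive.toPerm R.rE R.rE_rE) f

theorem sum_edgeEnergy_glue [Fintype E] (R : EdgeReflection src tgt)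
    {b : ℝ} (hb : 0 ≤ b) (φ : E → ℝ) (z : Conf V × Conf V) :
    ∑ e, edgeEnergy src tgt b φ (R.glue z) e = R.leftEnergy b φ z.1 +
      R.leftEnergy b (R.reflect φ) z.2 +
      ∑ i, (R.crossTerm b φ i z.1 - R.crossTerm b 0 i z.2) ^ 2 / 2 := by
  classical
  have hright : R.leftEnergy b (R.reflect φ) z.2 = ∑ e, if ¬ R.P (src e) ∧ ¬ R.P (tgt e) then
      edgeEnergy src tgt b φ (fun x => z.2 (R.r x)) e else 0 := by
    rw [leftEnergy, ← R.sum_rE]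
    refine Finset.sum_congr rfl fun e _ => ?_
    have := R.rE_mem_right (R.rE e)
    rw [R.rE_rE] at this
    simp only [edgeEnergy_reflect, ← this]
  have hsq : √b ^ 2 = b := Real.sq_sqrt hb
  rw [hright, leftEnergy, Fintype.sum_prod_type, ← Finset.sum_add_distrib,
    ← Finset.sum_add_distrib]
  refine Finset.sum_congr rfl fun e _ => ?_
  rw [Fintype.sum_bool]
  by_cases h1 : R.P (src e) <;> by_cases h2 : R.P (tgt e)
  · simp [edgeEnergy, crossTerm, h1, h2, glue_of_mem]
  · have h3 : R.r (tgt e) = src e := by rw [← R.cross e (by tauto), R.r_r]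
    simp only [edgeEnergy, crossTerm, h1, h2, glue_of_mem, glue_of_notMem, h3, not_false_eq_true,
      and_true, and_false, and_self, if_true, if_false, cond_true, cond_false, not_true_eq_false,
      Pi.zero_apply]
    linear_combination (-(acos (z.1 (src e)) - acos (z.2 (src e)) + φ e) ^ 2 / 2 -
      (asin (z.1 (src e)) - asin (z.2 (src e))) ^ 2 / 2) * hsq
  · have h3 : R.r (src e) = tgt e := R.cross e (by tauto)
    simp only [edgeEnergy, crossTerm, h1, h2, glue_of_mem, glue_of_notMem, h3, not_false_eq_true,
      and_true, and_false, and_self, if_true, if_false, cond_true, cond_false, not_true_eq_false,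
      Pi.zero_apply]
    linear_combination (-(acos (z.2 (tgt e)) - acos (z.1 (tgt e)) + φ e) ^ 2 / 2 -
      (asin (z.2 (tgt e)) - asin (z.1 (tgt e))) ^ 2 / 2) * hsq
  · simp [edgeEnergy, crossTerm, h1, h2, glue_of_notMem]

theorem shiftedPartition_eq [Fintype V] [Fintype E] (R : EdgeReflection src tgt)
    {b : ℝ} (hb : 0 ≤ b) (φ : E → ℝ) :
    shiftedPartition src tgt b φ = ∫ z, Real.exp (-R.leftEnergy b φ z.1) *
      Real.exp (-R.leftEnergy b (R.reflect φ) z.2) *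
      Real.exp (-∑ i, (R.crossTerm b φ i z.1 - R.crossTerm b 0 i z.2) ^ 2 / 2)
        ∂((unif V).prod (unif V)) := by
  rw [shiftedPartition, ← integral_comp_hom_prod R.glue R.continuous_glue R.glue_surjective
    (Φ := fun θ => Real.exp (-∑ e, edgeEnergy src tgt b φ θ e)) (by fun_prop)]
  simp only [R.sum_edgeEnergy_glue hb, neg_add, Real.exp_add]

open Classical in
/-- Keep the shifts inside `P`, and reflect them to the other side. -/
noncomputable def leftShift (R : EdgeReflection src tgt) (φ : E → ℝ) (e : E) : ℝ :=
  if R.P (src e) ∧ R.P (tgt e) then φ e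
  else if ¬ R.P (src e) ∧ ¬ R.P (tgt e) then R.sgn e * φ (R.rE e) else 0

theorem leftEnergy_congr [Fintype E] (R : EdgeReflection src tgt) (b : ℝ) {φ φ' : E → ℝ}
    (h : ∀ e, R.P (src e) → R.P (tgt e) → φ e = φ' e) : R.leftEnergy b φ = R.leftEnergy b φ' := by
  funext θ
  refine Finset.sum_congr rfl fun e _ => ?_
  split_ifs with he
  · rw [edgeEnergy, edgeEnergy, h e he.1 he.2]
  · rfl

theorem reflect_leftShift (R : EdgeReflection src tgt) (φ : E → ℝ) {e : E} (h1 : R.P (src e))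
    (h2 : R.P (tgt e)) : R.reflect (R.leftShift φ) e = φ e := by
  have h := (R.rE_mem_right e).2 ⟨h1, h2⟩
  rw [reflect, leftShift, if_neg (by tauto), if_pos h, R.rE_rE, ← mul_assoc, R.sgn_mul_self,
    one_mul]

theorem shiftedPartition_leftShift [Fintype V] [Fintype E] (R : EdgeReflection src tgt)
    {b : ℝ} (hb : 0 ≤ b) (φ : E → ℝ) :
    shiftedPartition src tgt b (R.leftShift φ) = ∫ z, Real.exp (-R.leftEnergy b φ z.1) *
      Real.exp (-R.leftEnergy b φ z.2) *
      Real.exp (-∑ i, (R.crossTerm b 0 i z.1 - R.crossTerm b 0 i z.2) ^ 2 / 2)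
        ∂((unif V).prod (unif V)) := by
  have h1 : R.leftEnergy b (R.leftShift φ) = R.leftEnergy b φ :=
    R.leftEnergy_congr b fun e h1 h2 => if_pos ⟨h1, h2⟩
  have h2 : R.leftEnergy b (R.reflect (R.leftShift φ)) = R.leftEnergy b φ :=
    R.leftEnergy_congr b fun e h1 h2 => R.reflect_leftShift φ h1 h2
  have h3 : R.crossTerm b (R.leftShift φ) = R.crossTerm b 0 := by
    funext i θ
    unfold crossTerm leftShift
    by_cases h1 : R.P (src i.1) <;> by_cases h2 : R.P (tgt i.1) <;> simp [h1, h2]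
  rw [R.shiftedPartition_eq hb, h1, h2, h3]

theorem two_mul_shiftedPartition_le [Fintype V] [Fintype E] (R : EdgeReflection src tgt)
    {b : ℝ} (hb : 0 ≤ b) (φ : E → ℝ) :
    2 * shiftedPartition src tgt b φ ≤ shiftedPartition src tgt b (R.leftShift φ) +
      shiftedPartition src tgt b (R.leftShift (R.reflect φ)) := by
  rw [R.shiftedPartition_eq hb φ, R.shiftedPartition_leftShift hb,
    R.shiftedPartition_leftShift hb]
  have hl := R.continuous_leftEnergy b
  refine (integral_gaussian_kernel_le (μ := unif V)
    (F := fun θ => Real.exp (-R.leftEnergy b φ θ))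
    (G := fun θ => Real.exp (-R.leftEnergy b (R.reflect φ) θ))
    (u := R.crossTerm b φ) (v := R.crossTerm b 0) (by fun_prop) (by fun_prop)
    (R.continuous_crossTerm b φ) (R.continuous_crossTerm b 0)).trans (le_of_eq ?_)
  have : ∀ i θ θ', R.crossTerm b φ i θ - R.crossTerm b φ i θ' =
      R.crossTerm b 0 i θ - R.crossTerm b 0 i θ' := by
    rintro ⟨e, _ | _⟩ θ θ' <;> unfold crossTerm <;> split_ifs <;>
      simp only [cond_true, cond_false, Pi.zero_apply] <;> ring
  simp only [this]

end EdgeReflection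

/-- Gaussian domination: if every edge crosses some reflection, the shifted partition function is
largest without shifts. -/
theorem shiftedPartition_le_zero [Fintype V] [Fintype E] (hR : ∀ e, ∃ R : EdgeReflection src tgt,
    ¬ (R.P (src e) ↔ R.P (tgt e))) {b : ℝ} (hb : 0 ≤ b) (φ : E → ℝ) :
    shiftedPartition src tgt b φ ≤ shiftedPartition src tgt b 0 := by
  classical
  let T : Finset ℝ := insert 0 (Finset.univ.image φ ∪ Finset.univ.image fun e => -φ e)
  have hT0 : (0 : ℝ) ∈ T := Finset.mem_insert_self _ _
  have hTneg : ∀ t ∈ T, -t ∈ T := by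
    intro t ht
    simp only [T, Finset.mem_insert, Finset.mem_union, Finset.mem_image, Finset.mem_univ,
      true_and] at ht ⊢
    rcases ht with rfl | ⟨e, rfl⟩ | ⟨e, rfl⟩
    · simp
    · exact .inr (.inr ⟨e, rfl⟩)
    · exact .inr (.inl ⟨e, by simp⟩)
  let S : Finset (E → ℝ) := Fintype.piFinset fun _ => T
  have hsgn : ∀ (R : EdgeReflection src tgt) e, ∀ t ∈ T, R.sgn e * t ∈ T := by
    intro R e t ht
    rcases R.compat e with h | h <;> rw [h.1]
    · rwa [one_mul]
    · rw [neg_one_mul]; exact hTneg t ht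
  have hrefl : ∀ (R : EdgeReflection src tgt), ∀ ψ ∈ S, R.reflect ψ ∈ S := fun R ψ hψ =>
    Fintype.mem_piFinset.2 fun e => hsgn R _ _ (Fintype.mem_piFinset.1 hψ _)
  have hleft : ∀ (R : EdgeReflection src tgt), ∀ ψ ∈ S, R.leftShift ψ ∈ S := fun R ψ hψ =>
    Fintype.mem_piFinset.2 fun e => by
      unfold EdgeReflection.leftShift
      split_ifs
      · exact Fintype.mem_piFinset.1 hψ _
      · exact hsgn R _ _ (Fintype.mem_piFinset.1 hψ _)
      · exact hT0
  have hφS : φ ∈ S := Fintype.mem_piFinset.2 fun e => by simp [T]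
  obtain ⟨ψ, hψS, hψ⟩ := S.exists_max_image (shiftedPartition src tgt b) ⟨φ, hφS⟩
  let nnz : (E → ℝ) → ℕ := fun ψ => ∑ e, if ψ e = 0 then 0 else 1
  obtain ⟨χ, hχ, hχmin⟩ := (S.filter fun χ => shiftedPartition src tgt b χ =
    shiftedPartition src tgt b ψ).exists_min_image nnz
    ⟨ψ, Finset.mem_filter.2 ⟨hψS, rfl⟩⟩
  rw [Finset.mem_filter] at hχ
  by_cases h0 : χ = 0
  · exact (hψ φ hφS).trans_eq (by rw [← hχ.2, h0])
  exfalso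
  obtain ⟨e, he⟩ : ∃ e, χ e ≠ 0 := by
    by_contra! h
    exact h0 (funext h)
  obtain ⟨R, hRe⟩ := hR e
  have h1 := R.two_mul_shiftedPartition_le hb χ
  have hLS := hleft R χ hχ.1
  have hRS := hleft R _ (hrefl R χ hχ.1)
  have h2 := hψ _ hLS
  have h3 := hψ _ hRS
  have h4 := hχmin _ (Finset.mem_filter.2 ⟨hLS, by linarith [hχ.2]⟩)
  have h5 := hχmin _ (Finset.mem_filter.2 ⟨hRS, by linarith [hχ.2]⟩)
  have hsgn0 : ∀ e, R.sgn e ≠ 0 := fun e h => by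
    have := R.sgn_mul_self e
    rw [h] at this
    norm_num at this
  have hl : ∀ ψ : E → ℝ, nnz (R.leftShift ψ) =
      2 * ∑ e, if R.P (src e) ∧ R.P (tgt e) then (if ψ e = 0 then 0 else 1) else 0 := by
    intro ψ
    have h6 : (∑ e, if R.P (src e) ∧ R.P (tgt e) then (if ψ e = 0 then 0 else 1) else 0) =
        ∑ e, if ¬ R.P (src e) ∧ ¬ R.P (tgt e) then (if ψ (R.rE e) = 0 then 0 else 1) else 0 := by
      rw [← R.sum_rE]
      refine Finset.sum_congr rfl fun e _ => ?_
      have := R.rE_mem_right (R.rE e)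
      rw [R.rE_rE] at this
      simp only [← this]
    rw [two_mul]
    nth_rewrite 2 [h6]
    rw [← Finset.sum_add_distrib]
    refine Finset.sum_congr rfl fun e _ => ?_
    unfold EdgeReflection.leftShift
    by_cases h1 : R.P (src e) <;> by_cases h2 : R.P (tgt e) <;> simp [h1, h2, hsgn0]
  have hr : (∑ e, if R.P (src e) ∧ R.P (tgt e) then
      (if R.reflect χ e = 0 then 0 else 1) else 0) =
      ∑ e, if ¬ R.P (src e) ∧ ¬ R.P (tgt e) then (if χ e = 0 then 0 else 1) else 0 := by
    rw [← R.sum_rE]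
    refine Finset.sum_congr rfl fun e _ => ?_
    have := R.rE_mem_right (R.rE e)
    rw [R.rE_rE] at this
    simp only [← this, EdgeReflection.reflect, R.rE_rE,
      mul_eq_zero, hsgn0, false_or]
  have hlt : (∑ e, if R.P (src e) ∧ R.P (tgt e) then (if χ e = 0 then 0 else 1) else 0) +
      (∑ e, if ¬ R.P (src e) ∧ ¬ R.P (tgt e) then (if χ e = 0 then 0 else 1) else 0) <
      nnz χ := by
    rw [← Finset.sum_add_distrib]
    refine Finset.sum_lt_sum (fun e _ => ?_) ⟨e, Finset.mem_univ e, ?_⟩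
    · by_cases h1 : R.P (src e) <;> by_cases h2 : R.P (tgt e) <;> simp [h1, h2]
    · rw [if_neg (by tauto), if_neg (by tauto), if_neg he]
      norm_num
  rw [hl] at h4 h5
  rw [hr] at h5
  omega

end ReflectionPositivity

section TorusReflection

theorem val_neg_one_sub {m : ℕ} [NeZero (2 * m)] (y : ZMod (2 * m)) :
    (-1 - y).val + y.val + 1 = 2 * m := by
  have hy := ZMod.val_lt y
  have h : (-1 - y : ZMod (2 * m)) = ((2 * m - 1 - y.val : ℕ) : ZMod (2 * m)) := by
    rw [Nat.cast_sub (by omega), Nat.cast_sub (by omega), ZMod.natCast_self, ZMod.natCast_zmod_val]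
    ring
  rw [h, ZMod.val_natCast_of_lt (by omega)]
  omega

theorem two_mul_add_one_eq_zero {m : ℕ} [NeZero (2 * m)] (y : ZMod (2 * m))
    (h : ¬ (y.val < m ↔ (y + 1).val < m)) : 2 * (y + 1) = 0 := by
  have hy := ZMod.val_lt y
  have h1 : y + 1 = ((y.val + 1 : ℕ) : ZMod (2 * m)) := by
    rw [Nat.cast_add, ZMod.natCast_zmod_val, Nat.cast_one]
  have h2 : y.val + 1 = m ∨ y.val + 1 = 2 * m := by
    by_contra! hne
    rw [h1, ZMod.val_natCast_of_lt (by omega)] at h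
    omega
  rw [h1]
  rcases h2 with h2 | h2 <;> rw [h2]
  · have := ZMod.natCast_self (2 * m)
    push_cast at this
    exact this
  · rw [ZMod.natCast_self, mul_zero]

/-- Reflection of the torus through the midpoints of the edges in direction `i` at height `c`. -/
def torReflection (m : ℕ) [NeZero (2 * m)] (i : Fin 3) (c : ZMod (2 * m)) :
    EdgeReflection (fun p : Tor (2 * m) × Fin 3 => p.1)
      (fun p => p.1 + Pi.single p.2 1) where
  r x := Function.update x i (2 * c + 1 - x i)
  rE p := if p.2 = i then (Function.update p.1 i (2 * c - p.1 i), p.2)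
    else (Function.update p.1 i (2 * c + 1 - p.1 i), p.2)
  sgn p := if p.2 = i then -1 else 1
  P x := (x i - c - 1).val < m
  r_r x := by simp
  rE_rE p := by
    obtain ⟨x, j⟩ := p
    by_cases h : j = i
    · subst h; simp
    · simp [h]
  P_r x := by
    have h := val_neg_one_sub (x i - c - 1)
    have h2 : -1 - (x i - c - 1) = 2 * c + 1 - x i - c - 1 := by ring
    rw [h2] at h
    simp only [Function.update_self]
    omega
  compat p := by
    obtain ⟨x, j⟩ := p
    by_cases h : j = i
    · subst h
      refine .inr ⟨by simp, ?_, ?_⟩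
      · simp only [if_true, Pi.add_apply, Pi.single_eq_same]
        funext k
        by_cases hk : k = j
        · subst hk; simp
        · simp [hk]
      · simp only [if_true]
        funext k
        by_cases hk : k = j
        · subst hk; simp; ring
        · simp [hk]
    · refine .inl ⟨by simp [h], by simp [h], ?_⟩
      simp only [if_neg h]
      funext k
      by_cases hk : k = i
      · subst hk; simp [Ne.symm h]
      · simp [hk]
  cross p hp := by
    obtain ⟨x, j⟩ := p
    by_cases h : j = i
    · subst h
      have h1 := two_mul_add_one_eq_zero (x j - c - 1) (by
        rw [show x j - c - 1 + 1 = x j + 1 - c - 1 by ring]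
        simpa using hp)
      funext k
      by_cases hk : k = j
      · subst hk
        simp
        linear_combination -h1
      · simp [hk]
    · simp [Ne.symm h] at hp

theorem exists_torReflection (m : ℕ) [NeZero (2 * m)] (e : Tor (2 * m) × Fin 3) :
    ∃ R : EdgeReflection (fun p : Tor (2 * m) × Fin 3 => p.1) (fun p => p.1 + Pi.single p.2 1),
      ¬ (R.P e.1 ↔ R.P (e.1 + Pi.single e.2 1)) := by
  refine ⟨torReflection m e.2 (e.1 e.2), ?_⟩
  have hm := NeZero.pos (2 * m)
  have h := val_neg_one_sub (0 : ZMod (2 * m))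
  simp [torReflection] at h ⊢
  omega

end TorusReflection

section Infrared

theorem one_add_sq_div_two_le_cosh (x : ℝ) : 1 + x ^ 2 / 2 ≤ Real.cosh x := by
  have h1 := Real.cosh_two_mul (x / 2)
  rw [mul_div_cancel₀ x two_ne_zero, Real.cosh_sq] at h1
  have h2 : (x / 2) ^ 2 ≤ Real.sinh (x / 2) ^ 2 := by
    rcases le_total 0 (x / 2) with h | h
    · have := Real.self_le_sinh_iff.2 h
      nlinarith
    · have := Real.sinh_le_self_iff.2 h
      nlinarith
  nlinarith

variable {V E : Type*} {src tgt : E → V}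

theorem edgeEnergy_eq (b : ℝ) (φ : E → ℝ) (θ : Conf V) (e : E) :
    edgeEnergy src tgt b φ θ e = b - b * acos (θ (src e) - θ (tgt e)) +
      b * (φ e * (acos (θ (src e)) - acos (θ (tgt e)))) + b / 2 * φ e ^ 2 := by
  rw [edgeEnergy, acos_sub]
  linear_combination (b / 2) * acos_sq_add_asin_sq (θ (src e)) +
    (b / 2) * acos_sq_add_asin_sq (θ (tgt e))

variable [Fintype V] [Fintype E]

/-- Gaussian domination implies a bound on the exponential moments of gradients. -/
theorem integral_cosh_le {b : ℝ} (hZ : ∀ φ, shiftedPartition src tgt b φ ≤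
    shiftedPartition src tgt b 0) (φ : E → ℝ) :
    ∫ θ, Real.cosh (b * ∑ e, φ e * (acos (θ (src e)) - acos (θ (tgt e)))) *
        Real.exp (∑ e, b * acos (θ (src e) - θ (tgt e))) ∂(unif V) ≤
      Real.exp (b / 2 * ∑ e, φ e ^ 2) *
        ∫ θ, Real.exp (∑ e, b * acos (θ (src e) - θ (tgt e))) ∂(unif V) := by
  have key : ∀ φ : E → ℝ, shiftedPartition src tgt b φ =
      Real.exp (-(∑ _e : E, b)) * (Real.exp (-(b / 2 * ∑ e, φ e ^ 2)) *
      ∫ θ, Real.exp (-(b * ∑ e, φ e * (acos (θ (src e)) - acos (θ (tgt e))))) *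
        Real.exp (∑ e, b * acos (θ (src e) - θ (tgt e))) ∂(unif V)) := by
    intro φ
    rw [shiftedPartition, ← integral_const_mul, ← integral_const_mul]
    refine integral_congr_ae (.of_forall fun θ => ?_)
    simp only [← Real.exp_add, edgeEnergy_eq, Finset.sum_add_distrib, Finset.sum_sub_distrib,
      Finset.mul_sum]
    congr 1
    ring
  have h1 := hZ φ
  have h2 := hZ (-φ)
  rw [key, key 0] at h1 h2
  have h3 := le_of_mul_le_mul_left h1 (Real.exp_pos _)
  have h4 := le_of_mul_le_mul_left h2 (Real.exp_pos _)
  simp only [Pi.neg_apply, neg_mul, Finset.sum_neg_distrib, mul_neg, neg_neg, even_two,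
    Even.neg_pow, Pi.zero_apply, zero_mul, Finset.sum_const_zero, mul_zero, neg_zero, ne_eq,
    OfNat.ofNat_ne_zero, not_false_eq_true, zero_pow, Real.exp_zero, one_mul] at h3 h4
  have h5 : ∀ x y : ℝ, Real.cosh x * y = Real.exp x * y / 2 + Real.exp (-x) * y / 2 :=
    fun x y => by rw [Real.cosh_eq]; ring
  simp only [h5]
  rw [integral_add (integrable_of_continuous (by fun_prop))
    (integrable_of_continuous (by fun_prop)), integral_div, integral_div]
  rw [Real.exp_neg, inv_mul_le_iff₀ (Real.exp_pos _)] at h3 h4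
  linarith

/-- The infrared bound, in real space. -/
theorem integral_sq_gradient_le {b : ℝ} (hb : 0 < b)
    (hZ : ∀ φ, shiftedPartition src tgt b φ ≤ shiftedPartition src tgt b 0) (φ : E → ℝ) :
    ∫ θ, (∑ e, φ e * (acos (θ (src e)) - acos (θ (tgt e)))) ^ 2 *
        Real.exp (∑ e, b * acos (θ (src e) - θ (tgt e))) ∂(unif V) ≤
      2 / b * (∑ e, φ e ^ 2) *
        ∫ θ, Real.exp (∑ e, b * acos (θ (src e) - θ (tgt e))) ∂(unif V) := by
  have hs : 0 ≤ ∑ e, φ e ^ 2 := Finset.sum_nonneg fun e _ => sq_nonneg _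
  rcases hs.eq_or_lt with h0 | h0
  · have hφ : ∀ e, φ e = 0 := fun e => by
      have := (Finset.sum_eq_zero_iff_of_nonneg fun e _ => sq_nonneg (φ e)).1 h0.symm e
        (Finset.mem_univ e)
      exact pow_eq_zero_iff (two_ne_zero) |>.1 this
    simp [hφ]
  set s := ∑ e, φ e ^ 2 with hs_def
  set t : ℝ := √(2 / (b * s)) with ht
  have ht2 : t ^ 2 = 2 / (b * s) := Real.sq_sqrt (by positivity)
  have h1 := integral_cosh_le hZ fun e => t * φ e
  have h2 : b / 2 * ∑ e, (t * φ e) ^ 2 = 1 := by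
    simp only [mul_pow, ← Finset.mul_sum, ht2, ← hs_def]
    field_simp
  rw [h2] at h1
  simp only [mul_assoc, ← Finset.mul_sum] at h1
  set Z := ∫ θ, Real.exp (∑ e, b * acos (θ (src e) - θ (tgt e))) ∂(unif V) with hZdef
  simp only [← Finset.mul_sum] at hZdef
  rw [← hZdef] at h1
  have hZpos : 0 ≤ Z := integral_nonneg fun _ => (Real.exp_pos _).le
  have h3 : ∫ θ, (Real.exp (∑ e, b * acos (θ (src e) - θ (tgt e))) + b / s *
      ((∑ e, φ e * (acos (θ (src e)) - acos (θ (tgt e)))) ^ 2 *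
        Real.exp (∑ e, b * acos (θ (src e) - θ (tgt e))))) ∂(unif V) ≤ Real.exp 1 * Z := by
    refine le_trans (integral_mono (integrable_of_continuous (by fun_prop))
      (integrable_of_continuous (by fun_prop)) fun θ => ?_) h1
    simp only [← Finset.mul_sum]
    set X := ∑ e, φ e * (acos (θ (src e)) - acos (θ (tgt e)))
    have h4 := one_add_sq_div_two_le_cosh (b * (t * X))
    have h5 : (b * (t * X)) ^ 2 / 2 = b / s * X ^ 2 := by
      rw [mul_pow, mul_pow, ht2]; field_simp
    rw [h5] at h4
    nlinarith [Real.exp_pos (b * ∑ e, acos (θ (src e) - θ (tgt e)))]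
  rw [integral_add (integrable_of_continuous (by fun_prop))
    (integrable_of_continuous (by fun_prop)), integral_const_mul] at h3
  set Y := ∫ θ, (∑ e, φ e * (acos (θ (src e)) - acos (θ (tgt e)))) ^ 2 *
        Real.exp (∑ e, b * acos (θ (src e) - θ (tgt e))) ∂(unif V)
  simp only [Finset.mul_sum] at hZdef
  rw [← hZdef] at h3
  have he : Real.exp 1 ≤ 3 := by linarith [Real.exp_one_lt_d9]
  have h6 : b / s * Y ≤ 2 * Z := by nlinarith
  rw [div_mul_eq_mul_div, div_le_iff₀ h0] at h6
  rw [div_mul_eq_mul_div, div_mul_eq_mul_div, le_div_iff₀ hb]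
  linarith

theorem torus_infrared_bound (m : ℕ) [NeZero (2 * m)] {b : ℝ} (hb : 0 < b)
    (φ : Tor (2 * m) × Fin 3 → ℝ) :
    gibbs (fun _ => b) (torEdge (2 * m))
      (fun θ => (∑ p, φ p * (acos (θ p.1) - acos (θ (p.1 + Pi.single p.2 1)))) ^ 2) ≤
      2 / b * ∑ p, φ p ^ 2 := by
  rw [gibbs, div_le_iff₀ (partition_pos _ fun p => continuous_torEdge _ p)]
  exact integral_sq_gradient_le (src := fun p : Tor (2 * m) × Fin 3 => p.1)
    (tgt := fun p => p.1 + Pi.single p.2 1) hb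
    (shiftedPartition_le_zero (exists_torReflection m) hb.le) φ

end Infrared

section BlockAverages

variable {V E : Type*} [AddCommGroup V] [NormedAddCommGroup E] [InnerProductSpace ℝ E]

/-- Average of `s` over the translate by `x` of the family `b`. -/
noncomputable def blockAvg {ι : Type*} [Fintype ι] (s : V → E) (b : ι → V) (x : V) : E :=
  (Fintype.card ι : ℝ)⁻¹ • ∑ a, s (x + b a)

theorem blockAvg_comm {ι κ : Type*} [Fintype ι] [Fintype κ] (s : V → E) (b : ι → V) (c : κ → V)
    (x : V) : blockAvg (blockAvg s b) c x = blockAvg (blockAvg s c) b x := by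
  simp only [blockAvg, ← Finset.smul_sum]
  rw [smul_comm, Finset.sum_comm]
  simp only [add_right_comm]

theorem norm_sub_blockAvg_le {κ : Type*} [Fintype κ] [Nonempty κ] (f : V → E) (c : κ → V) (x : V)
    {ε : ℝ} (h : ∀ a, ‖f x - f (x + c a)‖ ≤ ε) : ‖f x - blockAvg f c x‖ ≤ ε := by
  have hc : (0 : ℝ) < Fintype.card κ := Nat.cast_pos.2 Fintype.card_pos
  have : f x - blockAvg f c x = (Fintype.card κ : ℝ)⁻¹ • ∑ a, (f x - f (x + c a)) := by
    rw [Finset.sum_sub_distrib, smul_sub, Finset.sum_const, Finset.card_univ,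
      ← Nat.cast_smul_eq_nsmul ℝ, inv_smul_smul₀ hc.ne', blockAvg]
  rw [this, norm_smul, norm_inv, Real.norm_of_nonneg hc.le, inv_mul_le_iff₀ hc]
  refine (norm_sum_le _ _).trans ((Finset.sum_le_sum fun a _ => h a).trans ?_)
  simp

/-- The corner of a box, as an index set. -/
abbrev Box (l : ℕ) : Type := Fin 3 → Fin l

/-- The positions in a box spanned by the vectors `e`. -/
def boxPos (e : Fin 3 → V) (l : ℕ) (a : Box l) : V := ∑ i, (a i : ℕ) • e i

theorem card_box (j : ℕ) : (Fintype.card (Box (4 ^ j)) : ℝ) = (8 ^ j) ^ 2 := by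
  simp only [Fintype.card_pi, Fintype.card_fin, Finset.prod_const, Finset.card_univ]
  push_cast
  rw [← pow_mul, ← pow_mul, mul_comm j 3, mul_comm j 2, pow_mul, pow_mul]
  norm_num

variable {s : V → E} {e : Fin 3 → V} {C : ℝ}

theorem norm_blockAvg_sub_boxPos_le {ι : Type*} [Fintype ι] {δ : ℝ} {b : ι → V}
    (h : ∀ i x, ‖blockAvg s b x - blockAvg s b (x + e i)‖ ≤ δ) {l : ℕ} (a : Box l) (x : V) :
    ‖blockAvg s b x - blockAvg s b (x + boxPos e l a)‖ ≤ 3 * l * δ := by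
  have hδ : 0 ≤ δ := (norm_nonneg _).trans (h 0 0)
  have h1 : ∀ (i : Fin 3) (k : ℕ) (x : V),
      ‖blockAvg s b x - blockAvg s b (x + k • e i)‖ ≤ k * δ := by
    intro i k
    induction k with
    | zero => simp
    | succ k ih =>
      intro x
      rw [succ_nsmul, ← add_assoc]
      refine (norm_sub_le_norm_sub_add_norm_sub _ (blockAvg s b (x + k • e i)) _).trans ?_
      have := h i (x + k • e i)
      have := ih x
      push_cast
      linarith
  have h2 : ∀ (i : Fin 3) (x : V),
      ‖blockAvg s b x - blockAvg s b (x + (a i : ℕ) • e i)‖ ≤ l * δ := fun i x =>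
    (h1 i _ x).trans (mul_le_mul_of_nonneg_right (Nat.cast_le.2 (a i).2.le) hδ)
  rw [boxPos, Fin.sum_univ_three, ← add_assoc, ← add_assoc]
  have h3 := h2 0 x
  have h4 := h2 1 (x + (a 0 : ℕ) • e 0)
  have h5 := h2 2 (x + (a 0 : ℕ) • e 0 + (a 1 : ℕ) • e 1)
  have h6 := norm_sub_le_norm_sub_add_norm_sub (blockAvg s b x)
    (blockAvg s b (x + (a 0 : ℕ) • e 0)) (blockAvg s b (x + (a 0 : ℕ) • e 0 + (a 1 : ℕ) • e 1))
  refine (norm_sub_le_norm_sub_add_norm_sub _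
    (blockAvg s b (x + (a 0 : ℕ) • e 0 + (a 1 : ℕ) • e 1)) _).trans ?_
  linarith

theorem norm_blockAvg_sq {ι : Type*} [Fintype ι] (b : ι → V) :
    ‖blockAvg s b 0‖ ^ 2 =
      ((Fintype.card ι : ℝ)⁻¹) ^ 2 * ∑ a, ∑ a', inner ℝ (s (b a)) (s (b a')) := by
  rw [blockAvg, norm_smul, mul_pow, ← real_inner_self_eq_norm_sq (∑ a, s (0 + b a)), sum_inner]
  simp only [inner_sum, zero_add, norm_inv, Real.norm_natCast]

variable [Fintype V]

theorem norm_blockAvg_sub_step_le {ι : Type*} [Fintype ι] [Nonempty ι] (hC0 : 0 ≤ C)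
    (hC : ∀ φ : V × Fin 3 → ℝ, ‖∑ p, φ p • (s p.1 - s (p.1 + e p.2))‖ ^ 2 ≤ C ^ 2 * ∑ p, φ p ^ 2)
    {b : ι → V} (hb : Function.Injective b) (i : Fin 3) (x : V) :
    ‖blockAvg s b x - blockAvg s b (x + e i)‖ ≤ C / √(Fintype.card ι) := by
  classical
  have hc : (0 : ℝ) < Fintype.card ι := Nat.cast_pos.2 Fintype.card_pos
  let φ : V × Fin 3 → ℝ := fun p =>
    ∑ a, if p = (x + b a, i) then (Fintype.card ι : ℝ)⁻¹ else 0
  have h1 : ∑ p, φ p • (s p.1 - s (p.1 + e p.2)) =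
      blockAvg s b x - blockAvg s b (x + e i) := by
    simp only [φ, Finset.sum_smul, ite_smul, zero_smul]
    rw [Finset.sum_comm]
    simp only [Finset.sum_ite_eq', Finset.mem_univ, if_true]
    rw [← Finset.smul_sum, Finset.sum_sub_distrib, smul_sub]
    simp only [blockAvg, add_right_comm]
  have hinj : ∀ a a', (x + b a, i) = (x + b a', i) ↔ a = a' := fun a a' =>
    ⟨fun h => hb (add_left_cancel (Prod.ext_iff.1 h).1), fun h => h ▸ rfl⟩
  have h2 : ∑ p, φ p ^ 2 = (Fintype.card ι : ℝ)⁻¹ := by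
    simp only [φ, sq, Finset.sum_mul_sum, ite_mul, mul_ite, zero_mul, mul_zero]
    rw [Finset.sum_comm]
    have : ∀ a, ∑ p : V × Fin 3, ∑ a', (if p = (x + b a', i) then
        (if p = (x + b a, i) then (Fintype.card ι : ℝ)⁻¹ * (Fintype.card ι : ℝ)⁻¹ else 0)
        else 0) = (Fintype.card ι : ℝ)⁻¹ * (Fintype.card ι : ℝ)⁻¹ := by
      intro a
      rw [Finset.sum_comm]
      simp [hinj]
    simp [this, hc.ne']
  have h3 := hC φ
  rw [h1, h2] at h3
  rw [le_div_iff₀ (Real.sqrt_pos.2 hc)]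
  refine abs_le_of_sq_le_sq' ?_ hC0 |>.2
  rw [mul_pow, Real.sq_sqrt hc.le]
  rwa [← div_eq_mul_inv, le_div_iff₀ hc] at h3

theorem norm_blockAvg_sub_succ_le (hC0 : 0 ≤ C)
    (hC : ∀ φ : V × Fin 3 → ℝ, ‖∑ p, φ p • (s p.1 - s (p.1 + e p.2))‖ ^ 2 ≤ C ^ 2 * ∑ p, φ p ^ 2)
    {j : ℕ} (hj : Function.Injective (boxPos e (4 ^ j)))
    (hj' : Function.Injective (boxPos e (4 ^ (j + 1)))) (x : V) :
    ‖blockAvg s (boxPos e (4 ^ j)) x - blockAvg s (boxPos e (4 ^ (j + 1))) x‖ ≤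
      13 * C / 2 ^ j := by
  have hstep : ∀ j, Function.Injective (boxPos e (4 ^ j)) → ∀ i x,
      ‖blockAvg s (boxPos e (4 ^ j)) x - blockAvg s (boxPos e (4 ^ j)) (x + e i)‖ ≤
        C / 8 ^ j := fun j hj i x => by
    have := norm_blockAvg_sub_step_le hC0 hC hj i x
    rwa [card_box, Real.sqrt_sq (by positivity)] at this
  have h1 := norm_sub_blockAvg_le (blockAvg s (boxPos e (4 ^ j))) (boxPos e (4 ^ (j + 1))) x
    fun a => norm_blockAvg_sub_boxPos_le (hstep j hj) a x
  have h2 := norm_sub_blockAvg_le (blockAvg s (boxPos e (4 ^ (j + 1)))) (boxPos e (4 ^ j)) x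
    fun a => norm_blockAvg_sub_boxPos_le (hstep (j + 1) hj') a x
  rw [blockAvg_comm, norm_sub_rev] at h2
  refine (norm_sub_le_norm_sub_add_norm_sub _ _ _).trans ((add_le_add h1 h2).trans ?_)
  have h3 : (8 : ℝ) ^ j = 4 ^ j * 2 ^ j := by rw [← mul_pow]; norm_num
  push_cast
  rw [pow_succ, pow_succ, h3]
  have h4 : (0 : ℝ) < 4 ^ j := by positivity
  have h5 : (0 : ℝ) < 2 ^ j := by positivity
  have h6 : 3 * (4 ^ j * 4) * (C / (4 ^ j * 2 ^ j)) + 3 * 4 ^ j * (C / (4 ^ j * 2 ^ j * 8)) =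
      (12 + 3 / 8) * C / 2 ^ j := by
    field_simp
    ring
  rw [h6]
  gcongr
  norm_num

theorem norm_blockAvg_le (hC0 : 0 ≤ C)
    (hC : ∀ φ : V × Fin 3 → ℝ, ‖∑ p, φ p • (s p.1 - s (p.1 + e p.2))‖ ^ 2 ≤ C ^ 2 * ∑ p, φ p ^ 2)
    {j k : ℕ} (hj : ∀ l ≤ j + k, Function.Injective (boxPos e (4 ^ l))) (x : V) :
    ‖blockAvg s (boxPos e (4 ^ j)) x‖ ≤
      ‖blockAvg s (boxPos e (4 ^ (j + k))) x‖ + 26 * C / 2 ^ j := by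
  suffices h : ‖blockAvg s (boxPos e (4 ^ j)) x‖ ≤
      ‖blockAvg s (boxPos e (4 ^ (j + k))) x‖ + 26 * C * (1 / 2 ^ j - 1 / 2 ^ (j + k)) by
    refine h.trans ?_
    rw [mul_sub, mul_one_div]
    have : 0 ≤ 26 * C * (1 / 2 ^ (j + k)) := by positivity
    linarith
  induction k with
  | zero => simp
  | succ k ih =>
    have h1 := ih fun l hl => hj l (by omega)
    have h2 := norm_blockAvg_sub_succ_le hC0 hC (hj (j + k) (by omega))
      (hj (j + k + 1) (by omega)) x
    have h3 := norm_le_norm_add_norm_sub (blockAvg s (boxPos e (4 ^ (j + k + 1))) x)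
      (blockAvg s (boxPos e (4 ^ (j + k))) x)
    rw [norm_sub_rev] at h3
    have h4 : (1 : ℝ) / 2 ^ (j + (k + 1)) = 1 / 2 ^ (j + k) / 2 := by
      rw [← add_assoc, pow_succ]; field_simp
    rw [mul_div_assoc, ← mul_one_div] at h2
    rw [h4, ← add_assoc]
    linarith

end BlockAverages

section Tilted

variable {V I : Type*} [Fintype V] [Fintype I]

/-- The Gibbs measure of an XY model. -/
noncomputable abbrev gibbsMeasure (J : I → ℝ) (φ : I → Conf V →+ Ang) : Measure (Conf V) :=
  (unif V).tilted fun θ => ∑ i, J i * acos (φ i θ)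

theorem isProbabilityMeasure_gibbsMeasure (J : I → ℝ) {φ : I → Conf V →+ Ang}
    (hφ : ∀ i, Continuous (φ i)) : IsProbabilityMeasure (gibbsMeasure J φ) :=
  isProbabilityMeasure_tilted (integrable_of_continuous (by fun_prop))

theorem gibbs_eq_integral (J : I → ℝ) (φ : I → Conf V →+ Ang) (F : Conf V → ℝ) :
    gibbs J φ F = ∫ θ, F θ ∂(gibbsMeasure J φ) := by
  rw [gibbs, integral_tilted, ← integral_div]
  refine integral_congr_ae (Eventually.of_forall fun θ => ?_)
  simp only [smul_eq_mul]
  ring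

theorem gibbs_add_right (J : I → ℝ) {φ : I → Conf V →+ Ang} {c : Conf V}
    (hc : ∀ i, φ i c = 0) (F : Conf V → ℝ) : gibbs J φ (fun θ => F (θ + c)) = gibbs J φ F := by
  rw [gibbs, gibbs, ← integral_add_right_eq_self (μ := unif V) (fun θ => F θ * _) c]
  simp only [map_add, hc, add_zero]

theorem gibbs_add (J : I → ℝ) {φ : I → Conf V →+ Ang} (hφ : ∀ i, Continuous (φ i))
    {F G : Conf V → ℝ} (hF : Continuous F) (hG : Continuous G) :
    gibbs J φ (fun θ => F θ + G θ) = gibbs J φ F + gibbs J φ G := by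
  have := isProbabilityMeasure_gibbsMeasure J hφ
  simp only [gibbs_eq_integral]
  exact integral_add (integrable_of_continuous hF) (integrable_of_continuous hG)

theorem gibbs_acos_le_one (J : I → ℝ) {φ : I → Conf V →+ Ang} (hφ : ∀ i, Continuous (φ i))
    {χ : Conf V → Ang} (hχ : Continuous χ) : gibbs J φ (fun θ => acos (χ θ)) ≤ 1 := by
  have := isProbabilityMeasure_gibbsMeasure J hφ
  rw [gibbs_eq_integral]
  refine (integral_mono (integrable_of_continuous (by fun_prop)) (integrable_const 1)
    fun θ => acos_le_one _).trans_eq (by simp)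

theorem gibbs_sq_le (J : I → ℝ) {φ : I → Conf V →+ Ang} (hφ : ∀ i, Continuous (φ i))
    {F : Conf V → ℝ} (hF : Continuous F) : gibbs J φ F ^ 2 ≤ gibbs J φ (fun θ => F θ ^ 2) := by
  have := isProbabilityMeasure_gibbsMeasure J hφ
  simp only [gibbs_eq_integral]
  exact (even_two.convexOn_pow (𝕜 := ℝ)).map_integral_le (by fun_prop) isClosed_univ (by simp)
    (integrable_of_continuous hF) (integrable_of_continuous (by fun_prop))

end Tilted

section Torus

theorem boxPos_single {n : ℕ} (l : ℕ) (a : Box l) :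
    boxPos (V := Tor n) (fun i => Pi.single i 1) l a = red n fun i => ((a i : ℕ) : ℤ) := by
  ext j
  simp [boxPos, red, Finset.sum_apply, Pi.single_apply]

theorem boxPos_single_injective {n l : ℕ} (hl : l ≤ n) :
    Function.Injective (boxPos (V := Tor n) (fun i => Pi.single i 1) l) := by
  intro a a' h
  simp only [boxPos_single] at h
  ext i
  have := congrFun h i
  simp only [red, Int.cast_natCast] at this
  rwa [ZMod.natCast_eq_natCast_iff', Nat.mod_eq_of_lt ((a i).2.trans_le hl),
    Nat.mod_eq_of_lt ((a' i).2.trans_le hl)] at this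

variable {n : ℕ} [NeZero n]

theorem gibbs_acos_mul_acos (β : ℝ) (x y : Tor n) :
    gibbs (fun _ => β / 3) (torEdge n) (fun θ => acos (θ x) * acos (θ y)) =
      torCorr n β x y / 2 := by
  have h1 : gibbs (fun _ => β / 3) (torEdge n) (fun θ => asin (θ x) * asin (θ y)) =
      gibbs (fun _ => β / 3) (torEdge n) (fun θ => acos (θ x) * acos (θ y)) := by
    rw [← gibbs_add_right _ (c := fun _ => ((π / 2 : ℝ) : Ang)) (by simp [torEdge_apply])
      fun θ => acos (θ x) * acos (θ y)]
    simp only [Pi.add_apply, acos_add_pi_div_two, neg_mul_neg]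
  have h2 : torCorr n β x y = gibbs (fun _ => β / 3) (torEdge n)
      (fun θ => acos (θ x) * acos (θ y) + asin (θ x) * asin (θ y)) := by
    simp only [torCorr, acos_sub]
  rw [h2, gibbs_add _ (continuous_torEdge n) (by fun_prop) (by fun_prop), h1]
  ring

theorem torCorr_le_one (β : ℝ) (x y : Tor n) : torCorr n β x y ≤ 1 :=
  gibbs_acos_le_one _ (continuous_torEdge n) (χ := fun θ => θ x - θ y) (by fun_prop)

/-- The vectors `acos (θ x)` of a torus model realise half its two-point function as a Gram
matrix, and their gradients obey the infrared bound. -/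
theorem exists_hilbert_realization (m : ℕ) [NeZero (2 * m)] {β : ℝ} (hβ : 0 < β) :
    ∃ (E : Type) (_ : NormedAddCommGroup E) (_ : InnerProductSpace ℝ E) (s : Tor (2 * m) → E),
      (∀ x y, inner ℝ (s x) (s y) = torCorr (2 * m) β x y / 2) ∧
      ∀ φ : Tor (2 * m) × Fin 3 → ℝ, ‖∑ p, φ p • (s p.1 - s (p.1 + Pi.single p.2 1))‖ ^ 2 ≤
        √(6 / β) ^ 2 * ∑ p, φ p ^ 2 := by
  let ν := gibbsMeasure (fun _ => β / 3) (torEdge (2 * m))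
  have : IsProbabilityMeasure ν := isProbabilityMeasure_gibbsMeasure _ (continuous_torEdge _)
  let T := ContinuousMap.toLp (E := ℝ) 2 ν ℝ
  let c : Tor (2 * m) → C(Conf (Tor (2 * m)), ℝ) := fun x => ⟨fun θ => acos (θ x), by fun_prop⟩
  refine ⟨Lp ℝ 2 ν, inferInstance, inferInstance, fun x => T (c x), fun x y => ?_, fun φ => ?_⟩
  · rw [ContinuousMap.inner_toLp, ← gibbs_acos_mul_acos, gibbs_eq_integral]
    simp [c, ν, mul_comm]
  · have h1 : ∑ p, φ p • (T (c p.1) - T (c (p.1 + Pi.single p.2 1))) =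
        T (∑ p, φ p • (c p.1 - c (p.1 + Pi.single p.2 1))) := by
      simp only [map_sum, map_smul, map_sub]
    rw [h1, ← real_inner_self_eq_norm_sq, ContinuousMap.inner_toLp, Real.sq_sqrt (by positivity)]
    have h2 := torus_infrared_bound m (b := β / 3) (by positivity) φ
    rw [gibbs_eq_integral] at h2
    refine le_trans (le_of_eq ?_) (h2.trans_eq ?_)
    · refine integral_congr_ae (Eventually.of_forall fun θ => ?_)
      simp [c, sq, ContinuousMap.sum_apply]
    · congr 1; field_simp; norm_num

theorem sum_torCorr_le_of_injective {ι : Type*} [Fintype ι] {b : ι → Tor n}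
    (hb : Function.Injective b) {L : ℕ} (hL : 2 * L < n) {β : ℝ} (hβ : 0 ≤ β) :
    ∑ a, ∑ a', torCorr n β (b a) (b a') ≤
      (Fintype.card ι : ℝ) * (Fintype.card ι * magAt L β 0 + (interF L).card) := by
  classical
  rw [← nsmul_eq_mul, ← Finset.card_univ]
  refine Finset.sum_le_card_nsmul _ _ _ fun a _ => ?_
  have h1 : ∀ a', torCorr n β (b a) (b a') ≤
      magAt L β 0 + if rep (b a' - b a) ∈ interF L then 1 else 0 := by
    intro a'
    split_ifs with h
    · linarith [torCorr_le_one β (b a) (b a'), magAt_nonneg L hβ 0]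
    · simpa using torCorr_le_magAt hL hβ h
  refine (Finset.sum_le_sum fun a' _ => h1 a').trans ?_
  rw [Finset.sum_add_distrib, Finset.sum_const, nsmul_eq_mul, Finset.sum_boole]
  gcongr
  refine Finset.card_le_card_of_injOn (fun a' => rep (b a' - b a)) (fun a' h => ?_)
    fun x _ y _ h => hb (sub_left_injective (rep_injective h))
  simpa using h

end Torus

theorem sum_torCorr_le {β : ℝ} (hβ : 0 < β) (j k : ℕ) {m : ℕ} [NeZero (2 * m)]
    (hm : 4 ^ (j + k) = m) {L : ℕ} (hL : L < m) :
    ∑ a : Box (4 ^ j), ∑ a' : Box (4 ^ j), torCorr (2 * m) β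
        (red _ fun i => ((a i : ℕ) : ℤ)) (red _ fun i => ((a' i : ℕ) : ℤ)) ≤
      2 * ((8 ^ j) ^ 2) ^ 2 * (√((magAt L β 0 + (interF L).card / (8 ^ (j + k)) ^ 2) / 2) +
        26 * √(6 / β) / 2 ^ j) ^ 2 := by
  obtain ⟨E, _, _, s, hs, hC⟩ := exists_hilbert_realization m hβ
  have hinj : ∀ l ≤ j + k, Function.Injective
      (boxPos (V := Tor (2 * m)) (fun i => Pi.single i 1) (4 ^ l)) := fun l hl =>
    boxPos_single_injective (((Nat.pow_le_pow_right (by norm_num) hl).trans_eq hm).trans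
      (Nat.le_mul_of_pos_left _ two_pos))
  have h1 := norm_blockAvg_le (s := s) (e := fun i => Pi.single i 1) (j := j) (k := k)
    (Real.sqrt_nonneg _) hC hinj 0
  have h2 : ‖blockAvg s (boxPos (fun i => Pi.single i 1) (4 ^ (j + k))) 0‖ ≤
      √((magAt L β 0 + (interF L).card / (8 ^ (j + k)) ^ 2) / 2) := by
    refine Real.le_sqrt_of_sq_le ?_
    rw [norm_blockAvg_sq]
    simp only [hs, ← Finset.sum_div]
    have h3 := sum_torCorr_le_of_injective (hinj _ le_rfl) (by omega : 2 * L < _) hβ.le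
    have h4 : (0 : ℝ) < (8 ^ (j + k)) ^ 2 := by positivity
    rw [card_box] at h3 ⊢
    rw [← mul_div_assoc, div_le_div_iff_of_pos_right two_pos, inv_pow,
      inv_mul_le_iff₀ (by positivity)]
    refine h3.trans_eq ?_
    field_simp
  have h5 := norm_blockAvg_sq (s := s) (boxPos (fun i => Pi.single i 1) (4 ^ j))
  simp only [hs, ← Finset.sum_div, card_box, boxPos_single] at h5
  have h6 := pow_le_pow_left₀ (norm_nonneg _) (h1.trans (add_le_add_left h2 _)) 2
  rw [h5, inv_pow, inv_mul_le_iff₀ (by positivity)] at h6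
  linarith

/-- Where the magnetization vanishes, box averages of the free two-point function decay. -/
theorem sum_corr0_le {β : ℝ} (hβ : 0 < β) (hm : mStar β = 0) (j : ℕ)
    (L : Box (4 ^ j) → Box (4 ^ j) → ℕ)
    (h1 : ∀ a a', (fun i => ((a i : ℕ) : ℤ)) ∈ interF (L a a'))
    (h2 : ∀ a a', (fun i => ((a' i : ℕ) : ℤ)) ∈ interF (L a a')) :
    ∑ a, ∑ a', corr0 (L a a') β (fun i => ((a i : ℕ) : ℤ)) (fun i => ((a' i : ℕ) : ℤ)) ≤
      2 * ((8 ^ j) ^ 2) ^ 2 * (26 * √(6 / β) / 2 ^ j) ^ 2 := by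
  have key : ∀ δ > 0, ∑ a, ∑ a', corr0 (L a a') β (fun i => ((a i : ℕ) : ℤ))
      (fun i => ((a' i : ℕ) : ℤ)) ≤
        2 * ((8 ^ j) ^ 2) ^ 2 * (√δ + 26 * √(6 / β) / 2 ^ j) ^ 2 := by
    intro δ hδ
    obtain ⟨_, ⟨M, -, rfl⟩, hMδ⟩ := exists_lt_of_csInf_lt
      (s := {r : ℝ | ∃ L : ℕ, 2 ≤ L ∧ r = magAt L β 0}) ⟨_, 2, le_rfl, rfl⟩ (hm.trans_lt hδ)
    obtain ⟨k, hk⟩ := pow_unbounded_of_one_lt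
      (max ((interF M).card / δ) (max M (∑ a, ∑ a', L a a' : ℕ)) : ℝ) (by norm_num : (1 : ℝ) < 4)
    simp only [max_lt_iff] at hk
    obtain ⟨hk1, hk2, hk3⟩ := hk
    have hk4 : 4 ^ k ≤ 4 ^ (j + k) := Nat.pow_le_pow_right (by norm_num) (Nat.le_add_left _ _)
    have : NeZero (2 * 4 ^ (j + k)) := ⟨by positivity⟩
    have hL : ∀ a a', 2 * L a a' ≤ 2 * 4 ^ (j + k) := by
      intro a a'
      have h3 : ∑ a, ∑ a', L a a' < 4 ^ k := by exact_mod_cast hk3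
      have h4 := Finset.single_le_sum (f := fun a => ∑ a', L a a') (fun _ _ => Nat.zero_le _)
        (Finset.mem_univ a)
      have h5 := Finset.single_le_sum (f := fun a' => L a a') (fun _ _ => Nat.zero_le _)
        (Finset.mem_univ a')
      beta_reduce at h4
      omega
    refine (Finset.sum_le_sum fun a _ => Finset.sum_le_sum fun a' _ =>
      corr0_le_torCorr (hL a a') hβ.le (h1 a a') (h2 a a')).trans ?_
    refine (sum_torCorr_le hβ j k rfl (L := M) ?_).trans ?_
    · exact lt_of_lt_of_le (by exact_mod_cast hk2) hk4
    · have h3 : ((interF M).card : ℝ) / (8 ^ (j + k)) ^ 2 ≤ δ := by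
        rw [div_lt_iff₀ hδ] at hk1
        rw [div_le_iff₀ (by positivity), mul_comm]
        refine hk1.le.trans (mul_le_mul_of_nonneg_right ?_ hδ.le)
        rw [← pow_mul, mul_comm (j + k), pow_mul]
        refine (pow_le_pow_left₀ (by norm_num) (by norm_num) k).trans
          (pow_le_pow_right₀ (by norm_num) (Nat.le_add_left k j))
      gcongr
      linarith
  have h3 : Tendsto (fun δ => 2 * ((8 ^ j) ^ 2) ^ 2 * (√δ + 26 * √(6 / β) / 2 ^ j) ^ 2)
      (nhdsWithin 0 (Set.Ioi 0))
      (nhds (2 * ((8 ^ j) ^ 2) ^ 2 * (√0 + 26 * √(6 / β) / 2 ^ j) ^ 2)) :=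
    tendsto_nhdsWithin_of_tendsto_nhds (Continuous.tendsto (by fun_prop) 0)
  rw [Real.sqrt_zero, zero_add] at h3
  exact ge_of_tendsto h3 (eventually_mem_nhdsWithin.mono key)

theorem mem_interF_iff_supNorm {L : ℕ} {x : Site} : x ∈ interF L ↔ supNorm x < L := by
  simp [mem_interF, supNorm, Fin.forall_fin_succ]

theorem continuous_corr0 (L : ℕ) (x y : Site) : Continuous fun β => corr0 L β x y := by
  have h1 : ∀ p, Continuous fun β => freeJ L β p := fun p => by
    unfold freeJ; split_ifs <;> fun_prop
  have h2 : ∀ {F : ℝ → Conf ↥(interF L) → ℝ}, Continuous F.uncurry →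
      Continuous fun β => ∫ θ, F β θ ∂(unif ↥(interF L)) := fun hF => by
    simpa using continuous_parametric_integral_of_continuous (μ := unif ↥(interF L)) hF
      isCompact_univ
  simp only [fun β => corr0_eq_gibbs (L := L) Subtype.val_injective
    (fun k hk => ⟨⟨k, hk⟩, rfl⟩) β x y, gibbs]
  refine (h2 ?_).div (h2 ?_) fun β => (partition_pos _ fun _ => continuous_edgeHom _ _).ne'
  · unfold Function.uncurry
    fun_prop
  · unfold Function.uncurry
    fun_prop

theorem sq_sum_magAt_le {ι : Type*} [Fintype ι] (L : ℕ) (β : ℝ) (p : ι → Site) :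
    (∑ a, magAt L β (p a)) ^ 2 ≤ ∑ a, ∑ a', corrPlus L β (p a) (p a') := by
  obtain ⟨q, hq⟩ := exists_notMem_interF L
  let φ : ↥(lamF L) × Fin 3 → _ := fun r => edgeHom L (r.1.1, r.2)
  have hφ : ∀ r, Continuous (φ r) := fun _ => continuous_edgeHom _ _
  have := isProbabilityMeasure_gibbsMeasure (fun _ => β / 3) hφ
  have hrep : ∀ x y, corrPlus L β x y =
      ∫ θ, acos (evalHom L x θ - evalHom L y θ) ∂(gibbsMeasure (fun _ => β / 3) φ) := by
    intro x y
    rw [corrPlus_eq_gibbs Subtype.val_injective (fun k hk => ⟨⟨k, hk⟩, rfl⟩), gibbs_eq_integral]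
    rfl
  simp only [fun y => magAt_eq_corrPlus β y hq, hrep, evalHom_of_notMem hq, sub_zero]
  rw [← integral_finsetSum _ fun _ _ => integrable_of_continuous (by fun_prop),
    ← gibbs_eq_integral]
  refine (gibbs_sq_le _ hφ (by fun_prop)).trans ?_
  have hsum : ∑ a, ∑ a', ∫ θ, acos (evalHom L (p a) θ - evalHom L (p a') θ)
      ∂(gibbsMeasure (fun _ => β / 3) φ) =
      ∫ θ, ∑ a, ∑ a', acos (evalHom L (p a) θ - evalHom L (p a') θ)
        ∂(gibbsMeasure (fun _ => β / 3) φ) := by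
    rw [integral_finsetSum _ fun _ _ => integrable_of_continuous (by fun_prop)]
    refine Finset.sum_congr rfl fun a _ => ?_
    rw [integral_finsetSum _ fun _ _ => integrable_of_continuous (by fun_prop)]
  rw [hsum, gibbs_eq_integral]
  refine integral_mono (integrable_of_continuous (by fun_prop))
    (integrable_of_continuous (by fun_prop)) fun θ => ?_
  simp only [acos_sub, Finset.sum_add_distrib, ← Finset.sum_mul_sum, ← sq]
  exact le_add_of_nonneg_right (sq_nonneg _)

theorem exists_supNorm_lt (x y : Site) : ∃ L : ℕ, max (supNorm x) (supNorm y) < L :=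
  ⟨(max (supNorm x) (supNorm y)).toNat + 1, by omega⟩

theorem exists_lt_corr0_add (β : ℝ) (x y : Site) {ε : ℝ} (hε : 0 < ε) :
    ∃ L : ℕ, max (supNorm x) (supNorm y) < L ∧ S20 β x y < corr0 L β x y + ε := by
  obtain ⟨L₀, hL₀⟩ := exists_supNorm_lt x y
  obtain ⟨_, ⟨L, hL, rfl⟩, h⟩ := exists_lt_of_lt_csSup
    (s := {r : ℝ | ∃ L : ℕ, max (supNorm x) (supNorm y) < (L : ℤ) ∧ r = corr0 L β x y})
    ⟨_, L₀, hL₀, rfl⟩ (sub_lt_self (S20 β x y) hε)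
  exact ⟨L, hL, sub_lt_iff_lt_add.1 h⟩

theorem exists_corrPlus_lt_add (β : ℝ) (x y : Site) {ε : ℝ} (hε : 0 < ε) :
    ∃ L : ℕ, corrPlus L β x y < sInf {r : ℝ | ∃ L : ℕ, max (supNorm x) (supNorm y) < (L : ℤ) ∧
      r = corrPlus L β x y} + ε := by
  obtain ⟨L₀, hL₀⟩ := exists_supNorm_lt x y
  obtain ⟨_, ⟨L, -, rfl⟩, h⟩ := exists_lt_of_csInf_lt
    (s := {r : ℝ | ∃ L : ℕ, max (supNorm x) (supNorm y) < (L : ℤ) ∧ r = corrPlus L β x y})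
    ⟨_, L₀, hL₀, rfl⟩ (lt_add_of_pos_right _ hε)
  exact ⟨L, h⟩

/-- Box averages of the infinite-volume free two-point function decay at limits of inverse
temperatures without magnetization. -/
theorem sum_S20_le {β : ℝ} (hβ : 0 < β) (hm : β ∈ closure {β : ℝ | 0 < β ∧ mStar β = 0}) (j : ℕ) :
    ∑ a : Box (4 ^ j), ∑ a' : Box (4 ^ j),
        S20 β (fun i => ((a i : ℕ) : ℤ)) (fun i => ((a' i : ℕ) : ℤ)) ≤
      2 * ((8 ^ j) ^ 2) ^ 2 * (26 * √(6 / β) / 2 ^ j) ^ 2 := by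
  refine le_of_forall_pos_le_add fun ε hε => ?_
  have hN : (0 : ℝ) < (8 ^ j) ^ 2 := by positivity
  choose L hL h1 using fun a a' : Box (4 ^ j) => exists_lt_corr0_add β (fun i => ((a i : ℕ) : ℤ))
    (fun i => ((a' i : ℕ) : ℤ)) (ε := ε / ((8 ^ j) ^ 2) ^ 2) (by positivity)
  refine (Finset.sum_le_sum fun a _ => Finset.sum_le_sum fun a' _ => (h1 a a').le).trans ?_
  simp only [Finset.sum_add_distrib, Finset.sum_const, Finset.card_univ, nsmul_eq_mul, card_box]
  have h2 : ((8 : ℝ) ^ j) ^ 2 * ((8 ^ j) ^ 2 * (ε / ((8 ^ j) ^ 2) ^ 2)) = ε := by field_simp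
  rw [h2]
  gcongr
  obtain ⟨u, hu, hlim⟩ := mem_closure_iff_seq_limit.1 hm
  have h3 : ContinuousAt (fun β : ℝ => 2 * ((8 ^ j) ^ 2) ^ 2 * (26 * √(6 / β) / 2 ^ j) ^ 2) β := by
    fun_prop (disch := exact hβ.ne')
  have h4 : Continuous fun β : ℝ => ∑ a : Box (4 ^ j), ∑ a' : Box (4 ^ j),
      corr0 (L a a') β (fun i => ((a i : ℕ) : ℤ)) (fun i => ((a' i : ℕ) : ℤ)) :=
    continuous_finsetSum _ fun a _ => continuous_finsetSum _ fun a' _ => continuous_corr0 _ _ _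
  exact le_of_tendsto_of_tendsto' ((h4.tendsto β).comp hlim) (h3.tendsto.comp hlim) fun t =>
    sum_corr0_le (hu t).1 (hu t).2 j L
      (fun a a' => mem_interF_iff_supNorm.2 ((le_max_left _ _).trans_lt (hL a a')))
      fun a a' => mem_interF_iff_supNorm.2 ((le_max_right _ _).trans_lt (hL a a'))

/-- The squared magnetization is bounded by box averages of the infinite-volume plus two-point
function. -/
theorem mStar_sq_le {β : ℝ} (hβ : 0 ≤ β) {ι : Type*} [Fintype ι] (p : ι → Site) :
    (Fintype.card ι * mStar β) ^ 2 ≤ ∑ a, ∑ a', sInf {r : ℝ | ∃ L : ℕ,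
      max (supNorm (p a)) (supNorm (p a')) < (L : ℤ) ∧ r = corrPlus L β (p a) (p a')} := by
  have h0 : Tendsto (fun ε : ℝ => ∑ a, ∑ a', (sInf {r : ℝ | ∃ L : ℕ,
      max (supNorm (p a)) (supNorm (p a')) < (L : ℤ) ∧ r = corrPlus L β (p a) (p a')} + ε))
      (nhdsWithin 0 (Set.Ioi 0)) (nhds (∑ a, ∑ a', (sInf {r : ℝ | ∃ L : ℕ,
      max (supNorm (p a)) (supNorm (p a')) < (L : ℤ) ∧ r = corrPlus L β (p a) (p a')} + 0))) :=
    tendsto_nhdsWithin_of_tendsto_nhds (Continuous.tendsto (by fun_prop) 0)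
  simp only [add_zero] at h0
  refine ge_of_tendsto h0 (eventually_mem_nhdsWithin.mono fun ε hε => ?_)
  choose L hL using fun a a' => exists_corrPlus_lt_add β (p a) (p a') hε
  have hle : ∀ a a', L a a' ≤ ∑ a, ∑ a', L a a' := fun a a' =>
    (Finset.single_le_sum (f := fun a' => L a a') (fun _ _ => Nat.zero_le _)
      (Finset.mem_univ a')).trans (Finset.single_le_sum (f := fun a => ∑ a', L a a')
        (fun _ _ => Nat.zero_le _) (Finset.mem_univ a))
  refine le_trans ?_ ((sq_sum_magAt_le (∑ a, ∑ a', L a a') β p).trans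
    (Finset.sum_le_sum fun a _ => Finset.sum_le_sum fun a' _ =>
      (corrPlus_antitone (hle a a') hβ _ _).trans (hL a a').le))
  have := mStar_nonneg hβ
  refine pow_le_pow_left₀ (by positivity) ?_ 2
  rw [← nsmul_eq_mul, ← Finset.card_univ]
  exact Finset.card_nsmul_le_sum _ _ _ fun a _ => mStar_le_magAt _ hβ _

end XY

/-- If the plus- and free-boundary two-point functions agree at `β_c`,
then the magnetization vanishes at the critical point. -/
theorem continuity_of_phase_transition
    (hbdd : BddAbove {β : ℝ | 0 < β ∧ mStar β = 0}) (hpos : 0 < critBeta)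
    (h : ∀ x y : Site,
      sInf {r : ℝ | ∃ L : ℕ, max (supNorm x) (supNorm y) < (L : ℤ) ∧ r = corrPlus L critBeta x y}
        = S20 critBeta x y) :
    mStar critBeta = 0 := by
  have hmem : critBeta ∈ closure {β : ℝ | 0 < β ∧ mStar β = 0} := by
    refine csSup_mem_closure (Set.nonempty_iff_ne_empty.2 fun he => hpos.ne' ?_) hbdd
    rw [critBeta, he, Real.sSup_empty]
  have key : ∀ j : ℕ, mStar critBeta ^ 2 ≤ 2 * 26 ^ 2 * (6 / critBeta) * (1 / 4) ^ j := by
    intro j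
    have h1 := XY.mStar_sq_le hpos.le (ι := XY.Box (4 ^ j)) fun a i => ((a i : ℕ) : ℤ)
    simp only [h] at h1
    have h2 := h1.trans (XY.sum_S20_le hpos hmem j)
    have h3 : (2 ^ j : ℝ) ^ 2 = 4 ^ j := by rw [← pow_mul, mul_comm, pow_mul]; norm_num
    rw [XY.card_box, mul_pow, mul_comm (2 : ℝ), mul_assoc, mul_le_mul_iff_right₀ (by positivity),
      div_pow, mul_pow, Real.sq_sqrt (by positivity), h3] at h2
    refine h2.trans_eq ?_
    rw [one_div, inv_pow]
    ring
  have hlim : Filter.Tendsto (fun j : ℕ => 2 * 26 ^ 2 * (6 / critBeta) * (1 / 4 : ℝ) ^ j)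
      Filter.atTop (nhds (2 * 26 ^ 2 * (6 / critBeta) * 0)) :=
    (tendsto_pow_atTop_nhds_zero_of_lt_one (by norm_num) (by norm_num)).const_mul _
  rw [mul_zero] at hlim
  exact pow_eq_zero_iff two_ne_zero |>.1 ((ge_of_tendsto' hlim key).antisymm (sq_nonneg _))
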